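/- arXiv:2510.12464 — 6 statements merged into one kernel-verified Lean document; each statement's English description precedes it below -/
import Mathlib

section
/- Explicit relaxation (source) term: the internal-energy moment of the standard collision operator evaluated at the two-temperature equilibrium is ∫_{ℝ³×[0,∞)} I · Q_s(M_r, M_r)(ξ,I) dξ dI = C · (k_B^{α+1+β/2} / m^{2+β/2}) · ρ² T_tr^{β/2} T_int^α · (T_tr − T_int), where C = 2^{β+2} √π · [Γ(δ+α+1) Γ(δ/2)² Γ((β+5)/2)] / ( [δ+α+(β+3)/2] · Γ(δ)² ) · C_r and ρ = m n. -/
noncomputable section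

open MeasureTheory Real
open scoped BigOperators RealInnerProductSpace

abbrev V3 : Type := EuclideanSpace ℝ (Fin 3)

abbrev Sph : Type := Metric.sphere (0 : V3) 1

/-- The surface measure on the unit sphere `S²` (total mass `4π`). -/
def sphMeasure : Measure Sph := (volume : Measure V3).toSphere

/-- The measure `dξ dI` on `ℝ³ × [0,∞)`. -/
def phaseMeasure : Measure (V3 × ℝ) :=
  (volume : Measure V3).prod ((volume : Measure ℝ).restrict (Set.Ici 0))

/-- Total energy `E = (m/4)|ξ−ξ_*|² + I + I_*` in the center-of-mass frame. -/
def collE (m : ℝ) (ξ ξs : V3) (I Is : ℝ) : ℝ :=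
  m / 4 * ‖ξ - ξs‖ ^ 2 + I + Is

/-- Post-collisional velocity `ξ'` for standard (Borgnakke–Larsen) collisions. -/
def xiPrimeStd (m : ℝ) (ξ ξs : V3) (I Is R : ℝ) (σ : Sph) : V3 :=
  (1 / 2 : ℝ) • (ξ + ξs) + Real.sqrt (R * collE m ξ ξs I Is / m) • (σ : V3)

/-- Post-collisional velocity `ξ_*'` for standard collisions. -/
def xiStarPrimeStd (m : ℝ) (ξ ξs : V3) (I Is R : ℝ) (σ : Sph) : V3 :=
  (1 / 2 : ℝ) • (ξ + ξs) - Real.sqrt (R * collE m ξ ξs I Is / m) • (σ : V3)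

/-- Post-collisional internal energy `I' = r(1−R)E` for standard collisions. -/
def IPrimeStd (m : ℝ) (ξ ξs : V3) (I Is R r : ℝ) : ℝ :=
  r * (1 - R) * collE m ξ ξs I Is

/-- Post-collisional internal energy `I_*' = (1−r)(1−R)E` for standard collisions. -/
def IStarPrimeStd (m : ℝ) (ξ ξs : V3) (I Is R r : ℝ) : ℝ :=
  (1 - r) * (1 - R) * collE m ξ ξs I Is

/-- Integrand of the standard collision operator `Q_s`. -/
def stdIntegrand (m δ α β Cs : ℝ) (f F : V3 → ℝ → ℝ)
    (ξ : V3) (I : ℝ) (ξs : V3) (Is : ℝ) (σ : Sph) (r R : ℝ) : ℝ :=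
  ((f (xiPrimeStd m ξ ξs I Is R σ) (IPrimeStd m ξ ξs I Is R r) *
        F (xiStarPrimeStd m ξ ξs I Is R σ) (IStarPrimeStd m ξ ξs I Is R r) +
      f (xiStarPrimeStd m ξ ξs I Is R σ) (IStarPrimeStd m ξ ξs I Is R r) *
        F (xiPrimeStd m ξ ξs I Is R σ) (IPrimeStd m ξ ξs I Is R r)) /
      (IPrimeStd m ξ ξs I Is R r * IStarPrimeStd m ξ ξs I Is R r) ^ (δ / 2 - 1) -
    (f ξ I * F ξs Is + f ξs Is * F ξ I) / (I * Is) ^ (δ / 2 - 1)) *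
  (Cs * (I + Is) ^ α * ‖ξ - ξs‖ ^ β * (I * Is) ^ (δ / 2 - 1) *
    (r * (1 - r)) ^ (δ / 2 - 1) * (1 - R) ^ (α + δ - 1) * R ^ ((β + 1) / 2))

/-- The standard (inelastic) collision operator `Q_s(f,F)`. -/
def Qs (m δ α β Cs : ℝ) (f F : V3 → ℝ → ℝ) (ξ : V3) (I : ℝ) : ℝ :=
  (1 / 2) * ∫ Is in Set.Ici (0 : ℝ), ∫ ξs : V3,
    (∫ σ : Sph, (∫ r in Set.Icc (0 : ℝ) 1, ∫ R in Set.Icc (0 : ℝ) 1,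
      stdIntegrand m δ α β Cs f F ξ I ξs Is σ r R) ∂sphMeasure)

/-- Post-collisional velocity `ξ'` for resonant collisions. -/
def xiPrimeRes (ξ ξs : V3) (σ : Sph) : V3 :=
  (1 / 2 : ℝ) • (ξ + ξs) + (‖ξ - ξs‖ / 2) • (σ : V3)

/-- Post-collisional velocity `ξ_*'` for resonant collisions. -/
def xiStarPrimeRes (ξ ξs : V3) (σ : Sph) : V3 :=
  (1 / 2 : ℝ) • (ξ + ξs) - (‖ξ - ξs‖ / 2) • (σ : V3)

/-- Post-collisional internal energy `I' = r(I+I_*)` for resonant collisions. -/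
def IPrimeRes (I Is r : ℝ) : ℝ := r * (I + Is)

/-- Post-collisional internal energy `I_*' = (1−r)(I+I_*)` for resonant collisions. -/
def IStarPrimeRes (I Is r : ℝ) : ℝ := (1 - r) * (I + Is)

/-- Integrand of the resonant collision operator `Q_r`. -/
def resIntegrand (δ α β Cr : ℝ) (f F : V3 → ℝ → ℝ)
    (ξ : V3) (I : ℝ) (ξs : V3) (Is : ℝ) (σ : Sph) (r : ℝ) : ℝ :=
  ((f (xiPrimeRes ξ ξs σ) (IPrimeRes I Is r) * F (xiStarPrimeRes ξ ξs σ) (IStarPrimeRes I Is r) +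
      f (xiStarPrimeRes ξ ξs σ) (IStarPrimeRes I Is r) * F (xiPrimeRes ξ ξs σ) (IPrimeRes I Is r)) /
      (IPrimeRes I Is r * IStarPrimeRes I Is r) ^ (δ / 2 - 1) -
    (f ξ I * F ξs Is + f ξs Is * F ξ I) / (I * Is) ^ (δ / 2 - 1)) *
  (Cr * (I + Is) ^ α * ‖ξ - ξs‖ ^ β * (I * Is) ^ (δ / 2 - 1) * (r * (1 - r)) ^ (δ / 2 - 1))

/-- The resonant (elastic) collision operator `Q_r(f,F)`. -/
def Qr (δ α β Cr : ℝ) (f F : V3 → ℝ → ℝ) (ξ : V3) (I : ℝ) : ℝ :=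
  (1 / 2) * ∫ Is in Set.Ici (0 : ℝ), ∫ ξs : V3,
    (∫ σ : Sph, (∫ r in Set.Icc (0 : ℝ) 1,
      resIntegrand δ α β Cr f F ξ I ξs Is σ r) ∂sphMeasure)

/-- The Maxwellian equilibrium distribution `M_s`. -/
def Ms (m kB δ n T : ℝ) (u : V3) (ξ : V3) (I : ℝ) : ℝ :=
  n * I ^ (δ / 2 - 1) /
      ((2 * π * kB * T / m) ^ ((3 : ℝ) / 2) * (kB * T) ^ (δ / 2) * Real.Gamma (δ / 2)) *
    Real.exp (-(m * ‖ξ - u‖ ^ 2 + 2 * I) / (2 * kB * T))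

/-- The two-temperature equilibrium distribution `M_r`. -/
def Mr (m kB δ n Ttr Tint : ℝ) (u : V3) (ξ : V3) (I : ℝ) : ℝ :=
  n * I ^ (δ / 2 - 1) /
      ((2 * π * kB * Ttr / m) ^ ((3 : ℝ) / 2) * (kB * Tint) ^ (δ / 2) * Real.Gamma (δ / 2)) *
    Real.exp (-(m * ‖ξ - u‖ ^ 2) / (2 * kB * Ttr) - I / (kB * Tint))

/-- Integrand of the resonant linearized collision operator `L_r`. -/
def LrIntegrand (m kB δ n Ttr Tint α β : ℝ) (u : V3) (h : V3 → ℝ → ℝ)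
    (ξ : V3) (I : ℝ) (Is : ℝ) (ξs : V3) (σ : Sph) (r : ℝ) : ℝ :=
  Mr m kB δ n Ttr Tint u ξs Is *
    (h (xiStarPrimeRes ξ ξs σ) (IStarPrimeRes I Is r) + h (xiPrimeRes ξ ξs σ) (IPrimeRes I Is r) -
      h ξs Is - h ξ I) *
    (I + Is) ^ α * ‖ξ - ξs‖ ^ β * (r * (1 - r)) ^ (δ / 2 - 1)

/-- The resonant linearized collision operator `L_r`. -/
def Lr (m kB δ n Ttr Tint α β Cr : ℝ) (u : V3) (h : V3 → ℝ → ℝ) (ξ : V3) (I : ℝ) : ℝ :=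
  -Cr * ∫ Is in Set.Ici (0 : ℝ), ∫ ξs : V3,
    (∫ σ : Sph, (∫ r in Set.Icc (0 : ℝ) 1,
      LrIntegrand m kB δ n Ttr Tint α β u h ξ I Is ξs σ r) ∂sphMeasure)

/-- The product measure for the full 7-variable integrand of `Q_s`-moments:
variables `(ξ, I, ξ_*, I_*, σ, r, R)`. -/
def stdMeasure : Measure (V3 × ℝ × V3 × ℝ × Sph × ℝ × ℝ) :=
  (volume : Measure V3).prod
    (((volume : Measure ℝ).restrict (Set.Ici 0)).prod
      ((volume : Measure V3).prod
        (((volume : Measure ℝ).restrict (Set.Ici 0)).prod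
          (sphMeasure.prod
            (((volume : Measure ℝ).restrict (Set.Icc 0 1)).prod
              ((volume : Measure ℝ).restrict (Set.Icc 0 1)))))))

/-- The product measure for the full 6-variable integrand of `Q_r`-moments:
variables `(ξ, I, ξ_*, I_*, σ, r)`. -/
def resMeasure : Measure (V3 × ℝ × V3 × ℝ × Sph × ℝ) :=
  (volume : Measure V3).prod
    (((volume : Measure ℝ).restrict (Set.Ici 0)).prod
      ((volume : Measure V3).prod
        (((volume : Measure ℝ).restrict (Set.Ici 0)).prod
          (sphMeasure.prod ((volume : Measure ℝ).restrict (Set.Icc 0 1))))))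

/-- The product measure for the kernel variables `(I_*, ξ_*, σ, r)` of `L_r`. -/
def resKernelMeasure : Measure (ℝ × V3 × Sph × ℝ) :=
  ((volume : Measure ℝ).restrict (Set.Ici 0)).prod
    ((volume : Measure V3).prod (sphMeasure.prod ((volume : Measure ℝ).restrict (Set.Icc 0 1))))

theorem integrable_prod_of_nonneg_symm {X Y : Type*} [MeasurableSpace X] [MeasurableSpace Y]
    {μ : Measure X} {ν : Measure Y} [SFinite μ] [SFinite ν] {f : X × Y → ℝ} {h : Y → ℝ}
    (hf : Measurable f) (hf0 : ∀ᵐ y ∂ν, ∀ᵐ x ∂μ, 0 ≤ f (x, y))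
    (hfh : ∀ᵐ y ∂ν, Integrable (fun x => f (x, y)) μ ∧ ∫ x, f (x, y) ∂μ = h y)
    (hh : Integrable h ν) :
    Integrable f (μ.prod ν) ∧ ∫ z, f z ∂μ.prod ν = ∫ y, h y ∂ν := by
  have hint : Integrable f (μ.prod ν) := by
    refine (integrable_prod_iff' hf.aestronglyMeasurable).2 ⟨hfh.mono fun y hy => hy.1, ?_⟩
    refine hh.congr ?_
    filter_upwards [hf0, hfh] with y hy0 hy
    rw [← hy.2]
    refine integral_congr_ae ?_
    filter_upwards [hy0] with x hx
    rw [Real.norm_of_nonneg hx]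
  refine ⟨hint, ?_⟩
  rw [integral_prod_symm _ hint]
  exact integral_congr_ae (hfh.mono fun y hy => hy.2)

theorem integrable_prod_of_nonneg {X Y : Type*} [MeasurableSpace X] [MeasurableSpace Y]
    {μ : Measure X} {ν : Measure Y} [SFinite μ] [SFinite ν] {f : X × Y → ℝ} {h : X → ℝ}
    (hf : Measurable f) (hf0 : ∀ᵐ x ∂μ, ∀ᵐ y ∂ν, 0 ≤ f (x, y))
    (hfh : ∀ᵐ x ∂μ, Integrable (fun y => f (x, y)) ν ∧ ∫ y, f (x, y) ∂ν = h x)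
    (hh : Integrable h μ) :
    Integrable f (μ.prod ν) ∧ ∫ z, f z ∂μ.prod ν = ∫ x, h x ∂μ := by
  have := integrable_prod_of_nonneg_symm (hf.comp measurable_swap) hf0 hfh hh
  refine ⟨this.1.swap, ?_⟩
  rw [← this.2, ← integral_prod_swap]
  rfl

/-- The Gamma integral, together with its integrability. -/
theorem integrableOn_integral_gamma {a r : ℝ} (ha : 0 < a) (hr : 0 < r) :
    IntegrableOn (fun t : ℝ => t ^ (a - 1) * exp (-(r * t))) (Set.Ioi 0) ∧
      ∫ t in Set.Ioi (0 : ℝ), t ^ (a - 1) * exp (-(r * t)) = r ^ (-a) * Gamma a := by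
  constructor
  · have := integrableOn_rpow_mul_exp_neg_mul_rpow (s := a - 1) (by linarith) one_pos hr
    simpa using this
  · rw [integral_rpow_mul_exp_neg_mul_Ioi ha hr, one_div, inv_rpow hr.le, rpow_neg hr.le]

/-- The Beta integral over the half-line, in homogeneous form. -/
theorem integrableOn_integral_beta_Ioi {a b p q : ℝ} (ha : 0 < a) (hb : 0 < b) (hp : 0 < p)
    (hq : 0 < q) :
    IntegrableOn (fun v : ℝ => v ^ (b - 1) * (p * v + q) ^ (-(a + b))) (Set.Ioi 0) ∧
      ∫ v in Set.Ioi (0 : ℝ), v ^ (b - 1) * (p * v + q) ^ (-(a + b)) =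
        Gamma a * Gamma b / Gamma (a + b) * p ^ (-b) * q ^ (-a) := by
  have hG : 0 < Gamma (a + b) := Gamma_pos_of_pos (by linarith)
  have key := integrable_prod_of_nonneg (μ := volume.restrict (Set.Ioi (0 : ℝ)))
    (ν := volume.restrict (Set.Ioi (0 : ℝ)))
    (f := fun z : ℝ × ℝ => z.2 ^ (b - 1) * (z.1 ^ (a + b - 1) * exp (-((p * z.2 + q) * z.1))))
    (h := fun x => p ^ (-b) * Gamma b * (x ^ (a - 1) * exp (-(q * x))))
    (by fun_prop)
    (by
      filter_upwards [ae_restrict_mem measurableSet_Ioi] with x (hx : 0 < x)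
      filter_upwards [ae_restrict_mem measurableSet_Ioi] with y (hy : 0 < y)
      positivity)
    (by
      filter_upwards [ae_restrict_mem measurableSet_Ioi] with x (hx : 0 < x)
      have h := integrableOn_integral_gamma hb (mul_pos hp hx)
      have e : (fun y : ℝ => y ^ (b - 1) * (x ^ (a + b - 1) * exp (-((p * y + q) * x)))) =
          fun y => x ^ (a + b - 1) * exp (-(q * x)) * (y ^ (b - 1) * exp (-(p * x * y))) := by
        ext y
        rw [show -((p * y + q) * x) = -(q * x) + -(p * x * y) by ring, exp_add]
        ring
      simp only [e]
      refine ⟨h.1.const_mul _, ?_⟩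
      rw [integral_const_mul, h.2, mul_rpow hp.le hx.le,
        show a - 1 = (a + b - 1) + -b by ring, rpow_add hx]
      ring)
    ((integrableOn_integral_gamma ha hq).1.const_mul _)
  have hin : ∀ v ∈ Set.Ioi (0 : ℝ),
      ∫ x in Set.Ioi (0 : ℝ), v ^ (b - 1) * (x ^ (a + b - 1) * exp (-((p * v + q) * x))) =
        Gamma (a + b) * (v ^ (b - 1) * (p * v + q) ^ (-(a + b))) := by
    intro v (hv : 0 < v)
    rw [integral_const_mul, (integrableOn_integral_gamma (add_pos ha hb) (by positivity)).2]
    ring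
  constructor
  · have h1 : IntegrableOn (fun v => Gamma (a + b) * (v ^ (b - 1) * (p * v + q) ^ (-(a + b))))
        (Set.Ioi 0) :=
      IntegrableOn.congr_fun key.1.integral_prod_right hin measurableSet_Ioi
    refine (h1.const_mul (Gamma (a + b))⁻¹).congr (ae_of_all _ fun v => ?_)
    simp only []
    rw [inv_mul_cancel_left₀ hG.ne']
  · have h2 := key.2
    rw [integral_prod_symm _ key.1, setIntegral_congr_fun measurableSet_Ioi hin,
      integral_const_mul, integral_const_mul, (integrableOn_integral_gamma ha hq).2] at h2
    field_simp
    linarith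

/-- Feynman's parametrisation of the Beta integral over the unit interval. -/
theorem integrableOn_integral_feynman {a b p q : ℝ} (ha : 0 < a) (hb : 0 < b) (hp : 0 < p)
    (hq : 0 < q) :
    IntegrableOn (fun R : ℝ => R ^ (b - 1) * (1 - R) ^ (a - 1) *
        (R * p + (1 - R) * q) ^ (-(a + b))) (Set.Ioo 0 1) ∧
      ∫ R in Set.Ioo (0 : ℝ) 1, R ^ (b - 1) * (1 - R) ^ (a - 1) *
        (R * p + (1 - R) * q) ^ (-(a + b)) =
        Gamma a * Gamma b / Gamma (a + b) * p ^ (-b) * q ^ (-a) := by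
  set φ : ℝ → ℝ := fun v => v / (1 + v) with hφ
  have himg : φ '' Set.Ioi 0 = Set.Ioo 0 1 := by
    ext R
    constructor
    · rintro ⟨v, hv : 0 < v, rfl⟩
      have : 0 < 1 + v := by linarith
      exact ⟨by simp only [hφ]; positivity, by simp only [hφ]; rw [div_lt_one this]; linarith⟩
    · rintro ⟨h0, h1⟩
      have : 0 < 1 - R := by linarith
      refine ⟨R / (1 - R), div_pos h0 this, ?_⟩
      simp only [hφ]
      field_simp
      ring
  have hinj : Set.InjOn φ (Set.Ioi 0) := by
    intro v (hv : 0 < v) w (hw : 0 < w) h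
    simp only [hφ] at h
    rw [div_eq_div_iff (by positivity) (by positivity)] at h
    linarith
  have hder : ∀ v ∈ Set.Ioi (0 : ℝ), HasDerivWithinAt φ (1 / (1 + v) ^ 2) (Set.Ioi 0) v := by
    intro v (hv : 0 < v)
    have h := (hasDerivAt_id v).div ((hasDerivAt_id v).const_add 1)
      (show (1 : ℝ) + id v ≠ 0 by simp only [id]; positivity)
    refine HasDerivAt.hasDerivWithinAt (h.congr_deriv ?_)
    simp only [id]
    congr 1
    ring
  have hpt : ∀ v ∈ Set.Ioi (0 : ℝ), v ^ (b - 1) * (p * v + q) ^ (-(a + b)) =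
      |1 / (1 + v) ^ 2| • (φ v ^ (b - 1) * (1 - φ v) ^ (a - 1) *
        (φ v * p + (1 - φ v) * q) ^ (-(a + b))) := by
    intro v (hv : 0 < v)
    have h1 : 0 < 1 + v := by linarith
    have e1 : 1 - φ v = 1 / (1 + v) := by simp only [hφ]; field_simp; ring
    have e2 : φ v * p + (1 - φ v) * q = (p * v + q) / (1 + v) := by
      rw [e1]; simp only [hφ]; field_simp
    rw [e2, e1, abs_of_nonneg (by positivity), smul_eq_mul]
    simp only [hφ]
    rw [div_rpow hv.le h1.le, div_rpow zero_le_one h1.le, div_rpow (by positivity) h1.le, one_rpow]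
    have e3 : (1 + v) ^ 2 * ((1 + v) ^ (b - 1) * (1 + v) ^ (a - 1) * (1 + v) ^ (-(a + b))) = 1 := by
      rw [← rpow_natCast, ← rpow_add h1, ← rpow_add h1, ← rpow_add h1]
      rw [show ((2 : ℕ) : ℝ) + (b - 1 + (a - 1) + -(a + b)) = 0 by push_cast; ring, rpow_zero]
    have q1 : 0 < (1 + v) ^ (b - 1) := by positivity
    have q2 : 0 < (1 + v) ^ (a - 1) := by positivity
    have q3 : 0 < (1 + v) ^ (-(a + b)) := by positivity
    rw [div_mul_div_comm, div_mul_div_comm, div_mul_div_comm, e3]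
    ring
  have hβ := integrableOn_integral_beta_Ioi ha hb hp hq
  rw [← himg]
  constructor
  · rw [integrableOn_image_iff_integrableOn_abs_deriv_smul measurableSet_Ioi hder hinj]
    exact hβ.1.congr_fun hpt measurableSet_Ioi
  · rw [integral_image_eq_integral_abs_deriv_smul measurableSet_Ioi hder hinj, ← hβ.2]
    exact (setIntegral_congr_fun measurableSet_Ioi hpt).symm

/-- The Beta integral over the unit interval. -/
theorem integrableOn_integral_beta {a b : ℝ} (ha : 0 < a) (hb : 0 < b) :
    IntegrableOn (fun R : ℝ => R ^ (b - 1) * (1 - R) ^ (a - 1)) (Set.Ioo 0 1) ∧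
      ∫ R in Set.Ioo (0 : ℝ) 1, R ^ (b - 1) * (1 - R) ^ (a - 1) =
        Gamma a * Gamma b / Gamma (a + b) := by
  simpa using integrableOn_integral_feynman ha hb one_pos one_pos

/-- Feynman's parametrisation with the exponent raised by one. -/
theorem integrableOn_integral_feynman_succ {a b p q : ℝ} (ha : 0 < a) (hb : 0 < b) (hp : 0 < p)
    (hq : 0 < q) :
    IntegrableOn (fun R : ℝ => R ^ (b - 1) * (1 - R) ^ (a - 1) *
        (R * p + (1 - R) * q) ^ (-(a + b + 1))) (Set.Ioo 0 1) ∧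
      ∫ R in Set.Ioo (0 : ℝ) 1, R ^ (b - 1) * (1 - R) ^ (a - 1) *
        (R * p + (1 - R) * q) ^ (-(a + b + 1)) =
        Gamma a * Gamma b / Gamma (a + b) * p ^ (-b) * q ^ (-a) *
          ((a / q + b / p) / (a + b)) := by
  have h1 := integrableOn_integral_feynman (by linarith : 0 < a + 1) hb hp hq
  have h2 := integrableOn_integral_feynman ha (by linarith : 0 < b + 1) hp hq
  have hpt : ∀ R ∈ Set.Ioo (0 : ℝ) 1,
      R ^ (b - 1) * (1 - R) ^ (a + 1 - 1) * (R * p + (1 - R) * q) ^ (-(a + 1 + b)) +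
      R ^ (b + 1 - 1) * (1 - R) ^ (a - 1) * (R * p + (1 - R) * q) ^ (-(a + (b + 1))) =
      R ^ (b - 1) * (1 - R) ^ (a - 1) * (R * p + (1 - R) * q) ^ (-(a + b + 1)) := by
    rintro R ⟨h0, h1⟩
    have h1' : 0 < 1 - R := by linarith
    rw [show -(a + 1 + b) = -(a + b + 1) by ring, show -(a + (b + 1)) = -(a + b + 1) by ring,
      show a + 1 - 1 = a - 1 + 1 by ring, show b + 1 - 1 = b - 1 + 1 by ring,
      rpow_add_one h1'.ne', rpow_add_one h0.ne']
    ring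
  constructor
  · exact IntegrableOn.congr_fun (h1.1.add h2.1) hpt measurableSet_Ioo
  · rw [← setIntegral_congr_fun measurableSet_Ioo hpt, integral_add h1.1 h2.1, h1.2, h2.2,
      Gamma_add_one ha.ne', Gamma_add_one hb.ne', show a + 1 + b = a + b + 1 by ring,
      show a + (b + 1) = a + b + 1 by ring, Gamma_add_one (by positivity),
      show -(b + 1) = -b - 1 by ring, show -(a + 1) = -a - 1 by ring, rpow_sub_one hp.ne',
      rpow_sub_one hq.ne']
    have hG : 0 < Gamma (a + b) := Gamma_pos_of_pos (by linarith)
    field_simp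

/-- A double Gamma integral weighted by a power of the sum of the variables. -/
theorem integrable_integral_gamma_gamma {s t α r : ℝ} (hs : 0 < s) (ht : 0 < t) (hα : 0 ≤ α)
    (hr : 0 < r) :
    Integrable (fun z : ℝ × ℝ => z.1 ^ (s - 1) * z.2 ^ (t - 1) * (z.1 + z.2) ^ α *
        exp (-(r * (z.1 + z.2))))
      ((volume.restrict (Set.Ioi (0 : ℝ))).prod (volume.restrict (Set.Ioi (0 : ℝ)))) ∧
    ∫ z : ℝ × ℝ, z.1 ^ (s - 1) * z.2 ^ (t - 1) * (z.1 + z.2) ^ α * exp (-(r * (z.1 + z.2)))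
      ∂(volume.restrict (Set.Ioi (0 : ℝ))).prod (volume.restrict (Set.Ioi (0 : ℝ))) =
      Gamma s * Gamma t / Gamma (s + t) * Gamma (s + t + α) * r ^ (-(s + t + α)) := by
  have hc : 0 < s + t + α := by linarith
  have hB := integrableOn_integral_beta_Ioi hs ht one_pos one_pos
  have key := integrable_prod_of_nonneg_symm (μ := volume.restrict (Set.Ioi (0 : ℝ)))
    (ν := volume.restrict (Set.Ioi (0 : ℝ)))
    (f := fun z : ℝ × ℝ => z.2 ^ (t - 1) * (1 + z.2) ^ α *
      (z.1 ^ (s + t + α - 1) * exp (-(r * (1 + z.2) * z.1))))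
    (h := fun v => Gamma (s + t + α) * r ^ (-(s + t + α)) *
      (v ^ (t - 1) * (1 * v + 1) ^ (-(s + t))))
    (by fun_prop)
    (by
      filter_upwards [ae_restrict_mem measurableSet_Ioi] with v (hv : 0 < v)
      filter_upwards [ae_restrict_mem measurableSet_Ioi] with x (hx : 0 < x)
      positivity)
    (by
      filter_upwards [ae_restrict_mem measurableSet_Ioi] with v (hv : 0 < v)
      have h1 : 0 < 1 + v := by linarith
      have h := integrableOn_integral_gamma hc (mul_pos hr h1)
      refine ⟨h.1.const_mul _, ?_⟩
      rw [integral_const_mul, h.2, mul_rpow hr.le h1.le, one_mul, add_comm v 1,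
        show -(s + t) = α + -(s + t + α) by ring, rpow_add h1]
      ring)
    (hB.1.const_mul _)
  have h := integrable_prod_of_nonneg (μ := volume.restrict (Set.Ioi (0 : ℝ)))
    (ν := volume.restrict (Set.Ioi (0 : ℝ)))
    (f := fun z : ℝ × ℝ => z.1 ^ (s - 1) * z.2 ^ (t - 1) * (z.1 + z.2) ^ α *
      exp (-(r * (z.1 + z.2)))) (by fun_prop)
    (by
      filter_upwards [ae_restrict_mem measurableSet_Ioi] with x (hx : 0 < x)
      filter_upwards [ae_restrict_mem measurableSet_Ioi] with y (hy : 0 < y)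
      positivity)
    (by
      filter_upwards [ae_restrict_mem measurableSet_Ioi, key.1.prod_right_ae]
        with x (hx : 0 < x) hxi
      set g : ℝ → ℝ := fun y => x ^ (s - 1) * y ^ (t - 1) * (x + y) ^ α * exp (-(r * (x + y)))
      have e : ∀ v ∈ Set.Ioi (0 : ℝ), v ^ (t - 1) * (1 + v) ^ α *
          (x ^ (s + t + α - 1) * exp (-(r * (1 + v) * x))) = x * g (x * v) := by
        intro v (hv : 0 < v)
        simp only [g]
        rw [mul_rpow hx.le hv.le, show x + x * v = x * (1 + v) by ring,
          mul_rpow hx.le (by positivity),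
          show s + t + α - 1 = (s - 1) + (t - 1) + α + 1 by ring, rpow_add_one hx.ne',
          rpow_add hx, rpow_add hx, show r * (x * (1 + v)) = r * (1 + v) * x by ring]
        ring
      have h1 : IntegrableOn (fun v => x * g (x * v)) (Set.Ioi 0) :=
        IntegrableOn.congr_fun hxi e measurableSet_Ioi
      constructor
      · have h2 : IntegrableOn (fun v => g (x * v)) (Set.Ioi 0) := by
          refine (h1.const_mul x⁻¹).congr (ae_of_all _ fun v => ?_)
          simp only []
          rw [inv_mul_cancel_left₀ hx.ne']
        rw [integrableOn_Ioi_comp_mul_left_iff _ _ hx, mul_zero] at h2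
        exact h2
      · have h3 := setIntegral_congr_fun (μ := volume) measurableSet_Ioi e
        rw [integral_const_mul, integral_comp_mul_left_Ioi _ _ hx, mul_zero, smul_eq_mul,
          mul_inv_cancel_left₀ hx.ne'] at h3
        exact h3.symm)
    key.1.integral_prod_left
  refine ⟨h.1, ?_⟩
  rw [h.2, ← integral_prod _ key.1, key.2, integral_const_mul, hB.2]
  simp
  ring

theorem volume_real_ball_one_V3 : (volume : Measure V3).real (Metric.ball 0 1) = π * 4 / 3 := by
  rw [Measure.real, EuclideanSpace.volume_ball_fin_three]
  simp [ENNReal.toReal_ofReal (show 0 ≤ π * 4 / 3 by positivity)]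

theorem sphMeasure_real_univ : sphMeasure.real Set.univ = 4 * π := by
  rw [sphMeasure, Measure.toSphere_real_apply_univ, volume_real_ball_one_V3]
  simp
  ring

/-- Absolute moments of a centred Gaussian on `ℝ³`. -/
theorem integrable_integral_norm_rpow_gaussian {β k : ℝ} (hβ : 0 ≤ β) (hk : 0 < k) :
    Integrable (fun g : V3 => ‖g‖ ^ β * exp (-(k * ‖g‖ ^ 2))) ∧
      ∫ g : V3, ‖g‖ ^ β * exp (-(k * ‖g‖ ^ 2)) =
        2 * π * Gamma ((β + 3) / 2) * k ^ (-((β + 3) / 2)) := by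
  have hpt : ∀ y ∈ Set.Ioi (0 : ℝ), y ^ (β + 2) * exp (-k * y ^ (2 : ℝ)) =
      y ^ (Module.finrank ℝ V3 - 1) • (y ^ β * exp (-(k * y ^ 2))) := by
    intro y (hy : 0 < y)
    have : y ^ (β + 2) = y ^ β * y ^ 2 := by rw [rpow_add hy, rpow_two]
    rw [this, rpow_two, finrank_euclideanSpace_fin, smul_eq_mul, neg_mul]
    ring
  constructor
  · have := integrable_fun_norm_addHaar (volume : Measure V3)
      (f := fun y : ℝ => y ^ β * exp (-(k * y ^ 2)))
    refine this.2 (IntegrableOn.congr_fun ?_ hpt measurableSet_Ioi)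
    exact integrableOn_rpow_mul_exp_neg_mul_rpow (by linarith) two_pos hk
  · rw [integral_fun_norm_addHaar (volume : Measure V3) (fun y : ℝ => y ^ β * exp (-(k * y ^ 2))),
      ← setIntegral_congr_fun measurableSet_Ioi hpt,
      integral_rpow_mul_exp_neg_mul_rpow two_pos (by linarith) hk, volume_real_ball_one_V3,
      finrank_euclideanSpace_fin, show β + 2 + 1 = β + 3 by ring, neg_div]
    simp
    ring

theorem integrable_integral_gaussian_translate {k : ℝ} (hk : 0 < k) (v : V3) :
    Integrable (fun ξ : V3 => exp (-(k * ‖ξ + v‖ ^ 2))) ∧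
      ∫ ξ : V3, exp (-(k * ‖ξ + v‖ ^ 2)) = (π / k) ^ ((3 : ℝ) / 2) := by
  constructor
  · have h := (integrable_integral_norm_rpow_gaussian le_rfl hk).1
    simp only [rpow_zero, one_mul] at h
    exact h.comp_add_right v
  · rw [integral_add_right_eq_self (fun ξ : V3 => exp (-(k * ‖ξ‖ ^ 2))) v]
    have h := GaussianFourier.integral_rexp_neg_mul_sq_norm (V := V3) hk
    simpa using h

/-- Gaussian integral in centre-of-mass and relative velocity variables. -/
theorem integrable_integral_pair_gaussian {β k l : ℝ} (hβ : 0 ≤ β) (hk : 0 < k) (hl : 0 < l)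
    (u : V3) :
    Integrable (fun z : V3 × V3 => ‖z.1 - z.2‖ ^ β *
        exp (-(l * ‖(1 / 2 : ℝ) • (z.1 + z.2) - u‖ ^ 2) - k * ‖z.1 - z.2‖ ^ 2)) ∧
      ∫ z : V3 × V3, ‖z.1 - z.2‖ ^ β *
        exp (-(l * ‖(1 / 2 : ℝ) • (z.1 + z.2) - u‖ ^ 2) - k * ‖z.1 - z.2‖ ^ 2) =
        (π / l) ^ ((3 : ℝ) / 2) *
          (2 * π * Gamma ((β + 3) / 2) * k ^ (-((β + 3) / 2))) := by
  have hM := integrable_integral_norm_rpow_gaussian hβ hk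
  set f : V3 × V3 → ℝ := fun z => ‖z.2‖ ^ β *
    exp (-(l * ‖z.1 + ((1 / 2 : ℝ) • z.2 - u)‖ ^ 2) - k * ‖z.2‖ ^ 2) with hf
  have hfm : Measurable f := by fun_prop
  have key := integrable_prod_of_nonneg_symm (μ := (volume : Measure V3))
    (ν := (volume : Measure V3)) (f := f)
    (h := fun g => (π / l) ^ ((3 : ℝ) / 2) * (‖g‖ ^ β * exp (-(k * ‖g‖ ^ 2)))) hfm
    (ae_of_all _ fun y => ae_of_all _ fun x => by simp only [hf]; positivity)
    (ae_of_all _ fun g => by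
      have h := integrable_integral_gaussian_translate hl ((1 / 2 : ℝ) • g - u)
      have e : (fun x : V3 => f (x, g)) = fun x => ‖g‖ ^ β * exp (-(k * ‖g‖ ^ 2)) *
          exp (-(l * ‖x + ((1 / 2 : ℝ) • g - u)‖ ^ 2)) := by
        ext x
        simp only [hf]
        rw [sub_eq_add_neg, exp_add]
        ring
      rw [e]
      refine ⟨h.1.const_mul _, ?_⟩
      rw [integral_const_mul, h.2]
      ring)
    (hM.1.const_mul _)
  have hmp := measurePreserving_prod_sub (volume : Measure V3) (volume : Measure V3)
  have e : (fun z : V3 × V3 => ‖z.1 - z.2‖ ^ β *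
        exp (-(l * ‖(1 / 2 : ℝ) • (z.1 + z.2) - u‖ ^ 2) - k * ‖z.1 - z.2‖ ^ 2)) =
      f ∘ fun z : V3 × V3 => (z.1, z.2 - z.1) := by
    ext z
    simp only [hf, Function.comp]
    rw [norm_sub_rev z.1 z.2, show z.1 + ((1 / 2 : ℝ) • (z.2 - z.1) - u) =
      (1 / 2 : ℝ) • (z.1 + z.2) - u by module]
  rw [e]
  constructor
  · exact (hmp.integrable_comp hfm.aestronglyMeasurable).2 key.1
  · have h2 := key.2
    rw [integral_const_mul, hM.2] at h2
    rw [← h2]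
    conv_rhs => rw [← hmp.map_eq]
    rw [integral_map hmp.measurable.aemeasurable hfm.aestronglyMeasurable]
    rfl

/-- Product integrals with the four variables interleaved. -/
theorem integrable_integral_interleaved {X Y Z W : Type*} [MeasurableSpace X] [MeasurableSpace Y]
    [MeasurableSpace Z] [MeasurableSpace W] {μ : Measure X} {ν : Measure Y} {κ : Measure Z}
    {ρ : Measure W} [SFinite μ] [SFinite ν] [SFinite κ] [SFinite ρ]
    {A : X × W → ℝ} {B : Y × Z → ℝ} (hA : Measurable A) (hB : Measurable B)
    (hA0 : ∀ x, ∀ᵐ w ∂ρ, 0 ≤ A (x, w)) (hB0 : ∀ᵐ y ∂ν, ∀ᵐ z ∂κ, 0 ≤ B (y, z))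
    (hAi : Integrable A (μ.prod ρ)) (hBi : Integrable B (ν.prod κ)) :
    Integrable (fun z : (X × Y) × (Z × W) => A (z.1.1, z.2.2) * B (z.1.2, z.2.1))
        ((μ.prod ν).prod (κ.prod ρ)) ∧
      ∫ z : (X × Y) × (Z × W), A (z.1.1, z.2.2) * B (z.1.2, z.2.1) ∂(μ.prod ν).prod (κ.prod ρ) =
        (∫ z, A z ∂μ.prod ρ) * ∫ z, B z ∂ν.prod κ := by
  have h := integrable_prod_of_nonneg (μ := μ.prod ν) (ν := κ.prod ρ)
    (f := fun z : (X × Y) × (Z × W) => A (z.1.1, z.2.2) * B (z.1.2, z.2.1))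
    (h := fun p => (∫ w, A (p.1, w) ∂ρ) * ∫ z, B (p.2, z) ∂κ)
    (by fun_prop)
    (by
      filter_upwards [Measure.quasiMeasurePreserving_snd.ae hB0] with p hp
      filter_upwards [Measure.quasiMeasurePreserving_snd.ae (hA0 p.1),
        Measure.quasiMeasurePreserving_fst.ae hp] with q h1 h2
      exact mul_nonneg h1 h2)
    (by
      filter_upwards [Measure.quasiMeasurePreserving_fst.ae hAi.prod_right_ae,
        Measure.quasiMeasurePreserving_snd.ae hBi.prod_right_ae] with p h1 h2
      have e : (fun y : Z × W => A (p.1, y.2) * B (p.2, y.1)) =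
        fun y => B (p.2, y.1) * A (p.1, y.2) := by ext y; ring
      simp only [e]
      refine ⟨h2.mul_prod h1, ?_⟩
      rw [integral_prod_mul (fun z => B (p.2, z)) (fun w => A (p.1, w))]
      ring)
    (hAi.integral_prod_left.mul_prod hBi.integral_prod_left)
  refine ⟨h.1, ?_⟩
  rw [h.2, integral_prod_mul (fun x => ∫ w, A (x, w) ∂ρ) (fun y => ∫ z, B (y, z) ∂κ),
    ← integral_prod _ hAi, ← integral_prod _ hBi]

/-- Velocity factor of the moment density. -/
def velDensity (m β l x : ℝ) (u : V3) (z : V3 × V3) : ℝ :=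
  ‖z.1 - z.2‖ ^ β *
    exp (-(l * ‖(1 / 2 : ℝ) • (z.1 + z.2) - u‖ ^ 2) - x * (m / 4) * ‖z.1 - z.2‖ ^ 2)

/-- Internal-energy factor of the moment density. -/
def energyDensity (δ α y : ℝ) (z : ℝ × ℝ) : ℝ :=
  z.1 ^ (δ / 2 + 1 - 1) * z.2 ^ (δ / 2 - 1) * (z.1 + z.2) ^ α * exp (-(y * (z.1 + z.2)))

/-- Moment density in the variables `((ξ, I), (I_*, ξ_*))` and `R`, with inverse temperatures
`x R` and `y R` for the translational and internal modes. -/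
def momentDensity (m δ α β l : ℝ) (x y : ℝ → ℝ) (u : V3)
    (z : ((V3 × ℝ) × (ℝ × V3)) × ℝ) : ℝ :=
  velDensity m β l (x z.2) u (z.1.1.1, z.1.2.2) * energyDensity δ α (y z.2) (z.1.1.2, z.1.2.1) *
    (z.2 ^ ((β + 3) / 2 - 1) * (1 - z.2) ^ (δ + α - 1))

theorem integrable_integral_momentDensity {m δ α β l : ℝ} (hm : 0 < m) (hδ : 0 < δ) (hα : 0 ≤ α)
    (hβ : 0 ≤ β) (hl : 0 < l) {x y : ℝ → ℝ} (hxm : Measurable x) (hym : Measurable y)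
    (hx : ∀ R ∈ Set.Ioo (0 : ℝ) 1, 0 < x R) (hy : ∀ R ∈ Set.Ioo (0 : ℝ) 1, 0 < y R) (u : V3)
    (hint : IntegrableOn (fun R : ℝ => R ^ ((β + 3) / 2 - 1) * (1 - R) ^ (δ + α - 1) *
      (x R ^ (-((β + 3) / 2)) * y R ^ (-(δ + α + 1)))) (Set.Ioo 0 1)) :
    Integrable (momentDensity m δ α β l x y u)
        ((((volume : Measure V3).prod (volume.restrict (Set.Ioi (0 : ℝ)))).prod
          ((volume.restrict (Set.Ioi (0 : ℝ))).prod (volume : Measure V3))).prod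
          (volume.restrict (Set.Ioo (0 : ℝ) 1))) ∧
      ∫ z, momentDensity m δ α β l x y u z
        ∂((((volume : Measure V3).prod (volume.restrict (Set.Ioi (0 : ℝ)))).prod
          ((volume.restrict (Set.Ioi (0 : ℝ))).prod (volume : Measure V3))).prod
          (volume.restrict (Set.Ioo (0 : ℝ) 1))) =
        (π / l) ^ ((3 : ℝ) / 2) * (2 * π * Gamma ((β + 3) / 2) * (m / 4) ^ (-((β + 3) / 2))) *
          (Gamma (δ / 2 + 1) * Gamma (δ / 2) / Gamma (δ + 1) * Gamma (δ + α + 1)) *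
        ∫ R in Set.Ioo (0 : ℝ) 1, R ^ ((β + 3) / 2 - 1) * (1 - R) ^ (δ + α - 1) *
          (x R ^ (-((β + 3) / 2)) * y R ^ (-(δ + α + 1))) := by
  rw [← integral_const_mul]
  refine integrable_prod_of_nonneg_symm ?_ ?_ ?_ (hint.const_mul _)
  · unfold momentDensity velDensity energyDensity
    fun_prop
  · filter_upwards [ae_restrict_mem measurableSet_Ioo] with R hR
    have h1 : 0 < 1 - R := sub_pos.2 hR.2
    have h0 : 0 < R := hR.1
    filter_upwards [Measure.quasiMeasurePreserving_fst.ae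
        (Measure.quasiMeasurePreserving_snd.ae (ae_restrict_mem measurableSet_Ioi)),
      Measure.quasiMeasurePreserving_snd.ae
        (Measure.quasiMeasurePreserving_fst.ae (ae_restrict_mem measurableSet_Ioi))]
      with z (hz1 : 0 < z.1.2) (hz2 : 0 < z.2.1)
    unfold momentDensity velDensity energyDensity
    positivity
  · filter_upwards [ae_restrict_mem measurableSet_Ioo] with R hR
    have hxR := hx R hR
    have hyR := hy R hR
    have hA := integrable_integral_pair_gaussian hβ (by positivity : 0 < x R * (m / 4)) hl u
    have hB := integrable_integral_gamma_gamma (by positivity : 0 < δ / 2 + 1)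
      (by positivity : 0 < δ / 2) hα hyR
    have h := integrable_integral_interleaved (μ := (volume : Measure V3))
      (ν := volume.restrict (Set.Ioi (0 : ℝ))) (κ := volume.restrict (Set.Ioi (0 : ℝ)))
      (ρ := (volume : Measure V3)) (A := velDensity m β l (x R) u)
      (B := energyDensity δ α (y R)) (by unfold velDensity; fun_prop)
      (by unfold energyDensity; fun_prop)
      (fun _ => ae_of_all _ fun _ => by unfold velDensity; positivity)
      (by
        filter_upwards [ae_restrict_mem measurableSet_Ioi] with I (hI : 0 < I)
        filter_upwards [ae_restrict_mem measurableSet_Ioi] with J (hJ : 0 < J)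
        unfold energyDensity
        positivity) hA.1 hB.1
    simp only [momentDensity]
    refine ⟨h.1.mul_const _, ?_⟩
    rw [integral_mul_const, h.2]
    have hA2 : ∫ z, velDensity m β l (x R) u z ∂(volume : Measure V3).prod volume = _ := hA.2
    have hB2 : ∫ z, energyDensity δ α (y R) z ∂(volume.restrict (Set.Ioi (0 : ℝ))).prod
      (volume.restrict (Set.Ioi (0 : ℝ))) = _ := hB.2
    rw [hA2, hB2, mul_rpow hxR.le (by positivity), show δ / 2 + 1 + δ / 2 = δ + 1 by ring,
      show δ + 1 + α = δ + α + 1 by ring]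
    ring

/-- Product of two equilibrium distributions in centre-of-mass variables. -/
theorem Mr_mul_Mr_div {m kB δ n Ttr Tint : ℝ} (hkB : kB ≠ 0) (hTtr : Ttr ≠ 0)
    (u ξ ξs : V3) {I Is : ℝ} (hI : 0 < I) (hIs : 0 < Is) :
    Mr m kB δ n Ttr Tint u ξ I * Mr m kB δ n Ttr Tint u ξs Is / (I * Is) ^ (δ / 2 - 1) =
      (n / ((2 * π * kB * Ttr / m) ^ ((3 : ℝ) / 2) * (kB * Tint) ^ (δ / 2) *
        Gamma (δ / 2))) ^ 2 *
      exp (-(m / (kB * Ttr) * ‖(1 / 2 : ℝ) • (ξ + ξs) - u‖ ^ 2) -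
        1 / (kB * Ttr) * (m / 4) * ‖ξ - ξs‖ ^ 2 - 1 / (kB * Tint) * (I + Is)) := by
  have hpar : ‖ξ - u‖ ^ 2 + ‖ξs - u‖ ^ 2 =
      2 * ‖(1 / 2 : ℝ) • (ξ + ξs) - u‖ ^ 2 + ‖ξ - ξs‖ ^ 2 / 2 := by
    have h := parallelogram_law_with_norm ℝ (ξ - u) (ξs - u)
    have e1 : ξ - u + (ξs - u) = (2 : ℝ) • ((1 / 2 : ℝ) • (ξ + ξs) - u) := by module
    have e2 : ξ - u - (ξs - u) = ξ - ξs := by abel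
    rw [e1, e2, norm_smul, Real.norm_of_nonneg zero_le_two] at h
    linarith
  have hexp : exp (-(m / (kB * Ttr) * ‖(1 / 2 : ℝ) • (ξ + ξs) - u‖ ^ 2) -
        1 / (kB * Ttr) * (m / 4) * ‖ξ - ξs‖ ^ 2 - 1 / (kB * Tint) * (I + Is)) =
      exp (-(m * ‖ξ - u‖ ^ 2) / (2 * kB * Ttr) - I / (kB * Tint)) *
      exp (-(m * ‖ξs - u‖ ^ 2) / (2 * kB * Ttr) - Is / (kB * Tint)) := by
    rw [← exp_add]
    congr 1
    have h : -(m * ‖ξ - u‖ ^ 2) / (2 * kB * Ttr) + -(m * ‖ξs - u‖ ^ 2) / (2 * kB * Ttr) =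
        -(m / (2 * kB * Ttr) * (‖ξ - u‖ ^ 2 + ‖ξs - u‖ ^ 2)) := by ring
    have h2 : -(m / (kB * Ttr) * ‖(1 / 2 : ℝ) • (ξ + ξs) - u‖ ^ 2) -
        1 / (kB * Ttr) * (m / 4) * ‖ξ - ξs‖ ^ 2 =
        -(m / (2 * kB * Ttr) * (‖ξ - u‖ ^ 2 + ‖ξs - u‖ ^ 2)) := by
      rw [hpar]
      field_simp
      ring
    rw [h2, ← h]
    ring
  rw [hexp, Mr, Mr, mul_rpow hI.le hIs.le]
  have hI' : I ^ (δ / 2 - 1) ≠ 0 := (rpow_pos_of_pos hI _).ne'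
  have hIs' : Is ^ (δ / 2 - 1) ≠ 0 := (rpow_pos_of_pos hIs _).ne'
  rw [div_eq_iff (mul_ne_zero hI' hIs')]
  ring

/-- Pointwise form of the standard collision integrand at the two-temperature equilibrium. -/
theorem mul_stdIntegrand_Mr {m kB δ α β Cs n Ttr Tint : ℝ} (hm : 0 < m) (hkB : 0 < kB)
    (hTtr : 0 < Ttr) (u ξ ξs : V3) {I Is : ℝ} (hI : 0 < I) (hIs : 0 < Is)
    (σ : Sph) {r R : ℝ} (hr : r ∈ Set.Ioo (0 : ℝ) 1) (hR : R ∈ Set.Ioo (0 : ℝ) 1) :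
    I * stdIntegrand m δ α β Cs (Mr m kB δ n Ttr Tint u) (Mr m kB δ n Ttr Tint u)
        ξ I ξs Is σ r R =
      2 * (n / ((2 * π * kB * Ttr / m) ^ ((3 : ℝ) / 2) * (kB * Tint) ^ (δ / 2) *
        Gamma (δ / 2))) ^ 2 * Cs * (r ^ (δ / 2 - 1) * (1 - r) ^ (δ / 2 - 1)) *
      (momentDensity m δ α β (m / (kB * Ttr))
          (fun R => R * (1 / (kB * Ttr)) + (1 - R) * (1 / (kB * Tint)))
          (fun R => R * (1 / (kB * Ttr)) + (1 - R) * (1 / (kB * Tint))) u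
          (((ξ, I), (Is, ξs)), R) -
        momentDensity m δ α β (m / (kB * Ttr)) (fun _ => 1 / (kB * Ttr))
          (fun _ => 1 / (kB * Tint)) u (((ξ, I), (Is, ξs)), R)) := by
  obtain ⟨hr0, hr1⟩ := hr
  obtain ⟨hR0, hR1⟩ := hR
  have hr1' : 0 < 1 - r := sub_pos.2 hr1
  have hR1' : 0 < 1 - R := sub_pos.2 hR1
  have hE : 0 < collE m ξ ξs I Is := by unfold collE; positivity
  have hI' : 0 < IPrimeStd m ξ ξs I Is R r := by unfold IPrimeStd; positivity
  have hIs' : 0 < IStarPrimeStd m ξ ξs I Is R r := by unfold IStarPrimeStd; positivity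
  have hsum : IPrimeStd m ξ ξs I Is R r + IStarPrimeStd m ξ ξs I Is R r =
      (1 - R) * collE m ξ ξs I Is := by
    unfold IPrimeStd IStarPrimeStd; ring
  have hcom : (1 / 2 : ℝ) • (xiPrimeStd m ξ ξs I Is R σ + xiStarPrimeStd m ξ ξs I Is R σ) =
      (1 / 2 : ℝ) • (ξ + ξs) := by
    unfold xiPrimeStd xiStarPrimeStd; module
  have hrel : ‖xiPrimeStd m ξ ξs I Is R σ - xiStarPrimeStd m ξ ξs I Is R σ‖ ^ 2 =
      4 * (R * collE m ξ ξs I Is / m) := by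
    have e : xiPrimeStd m ξ ξs I Is R σ - xiStarPrimeStd m ξ ξs I Is R σ =
        (2 * √(R * collE m ξ ξs I Is / m)) • (σ : V3) := by
      unfold xiPrimeStd xiStarPrimeStd; module
    have hσ : ‖(σ : V3)‖ = 1 := by simp
    rw [e, norm_smul, hσ, mul_one, Real.norm_of_nonneg (by positivity), mul_pow,
      Real.sq_sqrt (by positivity)]
    norm_num
  have hloss := Mr_mul_Mr_div (m := m) (δ := δ) (n := n) (Tint := Tint) hkB.ne' hTtr.ne' u ξ ξs
    hI hIs
  have hgain := Mr_mul_Mr_div (m := m) (δ := δ) (n := n) (Tint := Tint) hkB.ne' hTtr.ne' u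
    (xiPrimeStd m ξ ξs I Is R σ) (xiStarPrimeStd m ξ ξs I Is R σ) hI' hIs'
  rw [hcom, hrel, hsum] at hgain
  have hexp : 1 / (kB * Ttr) * (m / 4) * (4 * (R * collE m ξ ξs I Is / m)) =
      R * (1 / (kB * Ttr)) * collE m ξ ξs I Is := by
    field_simp
  rw [hexp] at hgain
  have hg2 : -(m / (kB * Ttr) * ‖(1 / 2 : ℝ) • (ξ + ξs) - u‖ ^ 2) -
        R * (1 / (kB * Ttr)) * collE m ξ ξs I Is -
        1 / (kB * Tint) * ((1 - R) * collE m ξ ξs I Is) =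
      (-(m / (kB * Ttr) * ‖(1 / 2 : ℝ) • (ξ + ξs) - u‖ ^ 2) -
        (R * (1 / (kB * Ttr)) + (1 - R) * (1 / (kB * Tint))) * (m / 4) * ‖ξ - ξs‖ ^ 2) +
        -((R * (1 / (kB * Ttr)) + (1 - R) * (1 / (kB * Tint))) * (I + Is)) := by
    unfold collE; ring
  rw [hg2, exp_add] at hgain
  rw [sub_eq_add_neg _ (1 / (kB * Tint) * (I + Is)), exp_add] at hloss
  unfold stdIntegrand momentDensity velDensity energyDensity
  rw [mul_comm (Mr m kB δ n Ttr Tint u (xiStarPrimeStd m ξ ξs I Is R σ) _),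
    mul_comm (Mr m kB δ n Ttr Tint u ξs _), add_div, add_div, hgain, hloss,
    mul_rpow hr0.le hr1'.le, mul_rpow hI.le hIs.le, add_sub_cancel_right,
    show δ / 2 = δ / 2 - 1 + 1 by ring, rpow_add_one hI.ne', add_sub_cancel_right,
    show α + δ - 1 = δ + α - 1 by ring, show (β + 1) / 2 = (β + 3) / 2 - 1 by ring]
  ring

/-- The `σ`, `r`, `R` integrals of the collision integrand at the two-temperature equilibrium. -/
theorem mul_integral_stdIntegrand_Mr {m kB δ α β Cs n Ttr Tint : ℝ} (hm : 0 < m) (hkB : 0 < kB)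
    (hδ : 0 < δ) (hTtr : 0 < Ttr) (u ξ ξs : V3) {I Is : ℝ} (hI : 0 < I) (hIs : 0 < Is) :
    I * (∫ σ : Sph, (∫ r in Set.Icc (0 : ℝ) 1, ∫ R in Set.Icc (0 : ℝ) 1,
      stdIntegrand m δ α β Cs (Mr m kB δ n Ttr Tint u) (Mr m kB δ n Ttr Tint u)
        ξ I ξs Is σ r R) ∂sphMeasure) =
      4 * π * (Gamma (δ / 2) ^ 2 / Gamma δ) *
      (2 * (n / ((2 * π * kB * Ttr / m) ^ ((3 : ℝ) / 2) * (kB * Tint) ^ (δ / 2) *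
        Gamma (δ / 2))) ^ 2 * Cs) *
      ∫ R in Set.Ioo (0 : ℝ) 1, (momentDensity m δ α β (m / (kB * Ttr))
          (fun R => R * (1 / (kB * Ttr)) + (1 - R) * (1 / (kB * Tint)))
          (fun R => R * (1 / (kB * Ttr)) + (1 - R) * (1 / (kB * Tint))) u
          (((ξ, I), (Is, ξs)), R) -
        momentDensity m δ α β (m / (kB * Ttr)) (fun _ => 1 / (kB * Ttr))
          (fun _ => 1 / (kB * Tint)) u (((ξ, I), (Is, ξs)), R)) := by
  simp_rw [integral_Icc_eq_integral_Ioo, ← integral_const_mul I]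
  have h : ∀ σ : Sph, ∀ r ∈ Set.Ioo (0 : ℝ) 1, _ = _ := fun σ r hr =>
    setIntegral_congr_fun (μ := volume) measurableSet_Ioo fun R hR =>
      mul_stdIntegrand_Mr (α := α) (β := β) (Cs := Cs) (n := n) (Tint := Tint) (δ := δ)
        hm hkB hTtr u ξ ξs hI hIs σ hr hR
  simp_rw [setIntegral_congr_fun (μ := volume) measurableSet_Ioo (h _), integral_const_mul,
    integral_mul_const, integral_const_mul,
    (integrableOn_integral_beta (half_pos hδ) (half_pos hδ)).2, integral_const,
    sphMeasure_real_univ, add_halves, smul_eq_mul]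
  ring

theorem integrable_integral_gain {m δ α β l p q : ℝ} (hm : 0 < m) (hδ : 0 < δ) (hα : 0 ≤ α)
    (hβ : 0 ≤ β) (hl : 0 < l) (hp : 0 < p) (hq : 0 < q) (u : V3) :
    Integrable (momentDensity m δ α β l (fun R => R * p + (1 - R) * q)
        (fun R => R * p + (1 - R) * q) u)
        ((((volume : Measure V3).prod (volume.restrict (Set.Ioi (0 : ℝ)))).prod
          ((volume.restrict (Set.Ioi (0 : ℝ))).prod (volume : Measure V3))).prod
          (volume.restrict (Set.Ioo (0 : ℝ) 1))) ∧
      ∫ z, momentDensity m δ α β l (fun R => R * p + (1 - R) * q)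
        (fun R => R * p + (1 - R) * q) u z
        ∂((((volume : Measure V3).prod (volume.restrict (Set.Ioi (0 : ℝ)))).prod
          ((volume.restrict (Set.Ioi (0 : ℝ))).prod (volume : Measure V3))).prod
          (volume.restrict (Set.Ioo (0 : ℝ) 1))) =
        (π / l) ^ ((3 : ℝ) / 2) * (2 * π * Gamma ((β + 3) / 2) * (m / 4) ^ (-((β + 3) / 2))) *
          (Gamma (δ / 2 + 1) * Gamma (δ / 2) / Gamma (δ + 1) * Gamma (δ + α + 1)) *
        (Gamma (δ + α) * Gamma ((β + 3) / 2) / Gamma (δ + α + (β + 3) / 2) *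
          p ^ (-((β + 3) / 2)) * q ^ (-(δ + α)) *
          (((δ + α) / q + (β + 3) / 2 / p) / (δ + α + (β + 3) / 2))) := by
  have hF := integrableOn_integral_feynman_succ (by linarith : 0 < δ + α)
    (by linarith : 0 < (β + 3) / 2) hp hq
  have hpos : ∀ R ∈ Set.Ioo (0 : ℝ) 1, 0 < R * p + (1 - R) * q := fun R hR =>
    add_pos (mul_pos hR.1 hp) (mul_pos (sub_pos.2 hR.2) hq)
  have hpt : ∀ R ∈ Set.Ioo (0 : ℝ) 1,
      R ^ ((β + 3) / 2 - 1) * (1 - R) ^ (δ + α - 1) *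
        (R * p + (1 - R) * q) ^ (-(δ + α + (β + 3) / 2 + 1)) =
      R ^ ((β + 3) / 2 - 1) * (1 - R) ^ (δ + α - 1) *
        ((R * p + (1 - R) * q) ^ (-((β + 3) / 2)) *
          (R * p + (1 - R) * q) ^ (-(δ + α + 1))) := by
    intro R hR
    rw [← rpow_add (hpos R hR)]
    congr 2
    ring
  have h := integrable_integral_momentDensity hm hδ hα hβ hl (by fun_prop) (by fun_prop) hpos hpos
    u (hF.1.congr_fun hpt measurableSet_Ioo)
  refine ⟨h.1, ?_⟩
  rw [h.2, ← setIntegral_congr_fun measurableSet_Ioo hpt, hF.2]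

theorem integrable_integral_loss {m δ α β l p q : ℝ} (hm : 0 < m) (hδ : 0 < δ) (hα : 0 ≤ α)
    (hβ : 0 ≤ β) (hl : 0 < l) (hp : 0 < p) (hq : 0 < q) (u : V3) :
    Integrable (momentDensity m δ α β l (fun _ => p) (fun _ => q) u)
        ((((volume : Measure V3).prod (volume.restrict (Set.Ioi (0 : ℝ)))).prod
          ((volume.restrict (Set.Ioi (0 : ℝ))).prod (volume : Measure V3))).prod
          (volume.restrict (Set.Ioo (0 : ℝ) 1))) ∧
      ∫ z, momentDensity m δ α β l (fun _ => p) (fun _ => q) u z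
        ∂((((volume : Measure V3).prod (volume.restrict (Set.Ioi (0 : ℝ)))).prod
          ((volume.restrict (Set.Ioi (0 : ℝ))).prod (volume : Measure V3))).prod
          (volume.restrict (Set.Ioo (0 : ℝ) 1))) =
        (π / l) ^ ((3 : ℝ) / 2) * (2 * π * Gamma ((β + 3) / 2) * (m / 4) ^ (-((β + 3) / 2))) *
          (Gamma (δ / 2 + 1) * Gamma (δ / 2) / Gamma (δ + 1) * Gamma (δ + α + 1)) *
        (Gamma (δ + α) * Gamma ((β + 3) / 2) / Gamma (δ + α + (β + 3) / 2) *
          p ^ (-((β + 3) / 2)) * q ^ (-(δ + α)) * (1 / q)) := by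
  have hB := integrableOn_integral_beta (by linarith : 0 < δ + α)
    (by linarith : 0 < (β + 3) / 2)
  have h := integrable_integral_momentDensity hm hδ hα hβ hl measurable_const measurable_const
    (fun _ _ => hp) (fun _ _ => hq) u (hB.1.mul_const _)
  refine ⟨h.1, ?_⟩
  rw [h.2, integral_mul_const, hB.2, show -(δ + α + 1) = -(δ + α) - 1 by ring,
    rpow_sub_one hq.ne']
  ring

/-- Fubini for an iterated integral in the order occurring in moments of `Qs`. -/
theorem integral_iterated_eq {μ : Measure (V3 × ℝ)} {ν κ : Measure ℝ} [SFinite μ] [SFinite ν]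
    [SFinite κ] {f : ((V3 × ℝ) × (ℝ × V3)) × ℝ → ℝ}
    (hf : Integrable f ((μ.prod (ν.prod (volume : Measure V3))).prod κ)) :
    ∫ p, ∫ Is, ∫ ξs : V3, ∫ R, f ((p, (Is, ξs)), R) ∂κ ∂(volume : Measure V3) ∂ν ∂μ =
      ∫ z, f z ∂(μ.prod (ν.prod (volume : Measure V3))).prod κ := by
  rw [integral_prod _ hf, integral_prod _ hf.integral_prod_left]
  refine integral_congr_ae ?_
  filter_upwards [hf.integral_prod_left.prod_right_ae] with p hp
  rw [integral_prod _ hp]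

theorem integral_mul_Qs_Mr {m kB δ α β Cs n Ttr Tint : ℝ} (hm : 0 < m) (hkB : 0 < kB)
    (hδ : 0 < δ) (hα : 0 ≤ α) (hβ : 0 ≤ β) (hTtr : 0 < Ttr) (hTint : 0 < Tint) (u : V3) :
    ∫ p, p.2 * Qs m δ α β Cs (Mr m kB δ n Ttr Tint u) (Mr m kB δ n Ttr Tint u)
        p.1 p.2 ∂phaseMeasure =
      4 * π * (Gamma (δ / 2) ^ 2 / Gamma δ) *
      ((n / ((2 * π * kB * Ttr / m) ^ ((3 : ℝ) / 2) * (kB * Tint) ^ (δ / 2) *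
        Gamma (δ / 2))) ^ 2 * Cs) *
      ((π / (m / (kB * Ttr))) ^ ((3 : ℝ) / 2) *
          (2 * π * Gamma ((β + 3) / 2) * (m / 4) ^ (-((β + 3) / 2))) *
          (Gamma (δ / 2 + 1) * Gamma (δ / 2) / Gamma (δ + 1) * Gamma (δ + α + 1)) *
        (Gamma (δ + α) * Gamma ((β + 3) / 2) / Gamma (δ + α + (β + 3) / 2) *
          (1 / (kB * Ttr)) ^ (-((β + 3) / 2)) * (1 / (kB * Tint)) ^ (-(δ + α)) *
          (((δ + α) / (1 / (kB * Tint)) + (β + 3) / 2 / (1 / (kB * Ttr))) /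
            (δ + α + (β + 3) / 2) - 1 / (1 / (kB * Tint))))) := by
  have hp : 0 < 1 / (kB * Ttr) := by positivity
  have hq : 0 < 1 / (kB * Tint) := by positivity
  have hl : 0 < m / (kB * Ttr) := by positivity
  have hG := integrable_integral_gain hm hδ hα hβ hl hp hq u
  have hL := integrable_integral_loss hm hδ hα hβ hl hp hq u
  have hit := integral_iterated_eq (hG.1.sub hL.1)
  rw [integral_sub' hG.1 hL.1, hG.2, hL.2] at hit
  simp only [Pi.sub_apply] at hit
  rw [← mul_sub, ← mul_sub] at hit
  rw [← hit, ← integral_const_mul, phaseMeasure, Measure.restrict_congr_set Ioi_ae_eq_Ici.symm]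
  refine integral_congr_ae ?_
  filter_upwards [Measure.quasiMeasurePreserving_snd.ae (ae_restrict_mem measurableSet_Ioi)]
    with p (hp2 : 0 < p.2)
  rw [Qs, integral_Ici_eq_integral_Ioi, ← mul_assoc, ← integral_const_mul, ← integral_const_mul]
  refine setIntegral_congr_fun measurableSet_Ioi fun Is hIs => ?_
  rw [← integral_const_mul, ← integral_const_mul]
  refine integral_congr_ae (ae_of_all _ fun ξs => ?_)
  have h := mul_integral_stdIntegrand_Mr (α := α) (β := β) (Cs := Cs) (n := n) (Tint := Tint)
    hm hkB hδ hTtr u p.1 ξs hp2 hIs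
  beta_reduce
  linear_combination (1 / 2) * h

theorem rpow_three_halves_mul_rpow_div {X : ℝ} (hX : 0 < X) (β : ℝ) :
    (π * X) ^ ((3 : ℝ) / 2) * (4 * X) ^ ((β + 3) / 2) / ((2 * π * X) ^ ((3 : ℝ) / 2)) ^ 2 =
      √π / π ^ 2 * 2 ^ β * X ^ (β / 2) := by
  have hπ := pi_pos
  have h1 : ∀ y : ℝ, 0 < y → y ^ ((3 : ℝ) / 2) = y * √y := fun y hy => by
    rw [show (3 : ℝ) / 2 = 1 + 1 / 2 by norm_num, rpow_add hy, rpow_one, sqrt_eq_rpow]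
  have h2 : (4 : ℝ) ^ ((β + 3) / 2) = 8 * 2 ^ β := by
    rw [show (4 : ℝ) = 2 ^ (2 : ℝ) by norm_num, ← rpow_mul zero_le_two,
      show 2 * ((β + 3) / 2) = 3 + β by ring, rpow_add two_pos]
    norm_num
  have h3 : X ^ ((β + 3) / 2) = X ^ (β / 2) * (X * √X) := by
    rw [← h1 X hX, ← rpow_add hX]
    ring_nf
  rw [mul_rpow (by norm_num : (0 : ℝ) ≤ 4) hX.le, h1 _ (by positivity), h1 _ (by positivity),
    mul_pow, sq_sqrt (by positivity), h2, h3, sqrt_mul hπ.le]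
  have hs : √X * √X = X := mul_self_sqrt hX.le
  field_simp
  linear_combination 8 * hs

/-- explicit relaxation (source) term: the internal-energy moment of
`Q_s(M_r, M_r)`. -/
theorem source_term_explicit (m kB δ α β Cr Cs : ℝ) (hm : 0 < m) (hkB : 0 < kB) (hδ : 2 ≤ δ)
    (hα : α ∈ Set.Ico (0:ℝ) (δ / 2)) (hβ : β ∈ Set.Icc (0:ℝ) 1) (hCr : 0 < Cr)
    (hCs : Cs = Real.Gamma (δ + α + (β + 3) / 2) /
      (Real.Gamma ((β + 3) / 2) * Real.Gamma (δ + α)) * Cr)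
    (n Ttr Tint : ℝ) (hn : 0 < n) (hTtr : 0 < Ttr) (hTint : 0 < Tint) (u : V3) :
    (∫ p, p.2 * Qs m δ α β Cs (Mr m kB δ n Ttr Tint u) (Mr m kB δ n Ttr Tint u)
        p.1 p.2 ∂phaseMeasure) =
      ((2:ℝ) ^ (β + 2) * Real.sqrt π *
          (Real.Gamma (δ + α + 1) * Real.Gamma (δ / 2) ^ 2 * Real.Gamma ((β + 5) / 2)) /
          ((δ + α + (β + 3) / 2) * Real.Gamma δ ^ 2) * Cr) *
        (kB ^ (α + 1 + β / 2) / m ^ (2 + β / 2)) * (m * n) ^ 2 *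
        Ttr ^ (β / 2) * Tint ^ α * (Ttr - Tint) := by
  have hδ0 : 0 < δ := by linarith
  have hα0 := hα.1
  have hβ0 := hβ.1
  rw [integral_mul_Qs_Mr hm hkB hδ0 hα0 hβ0 hTtr hTint u, hCs]
  have hT : 0 < kB * Tint := mul_pos hkB hTint
  have hX : 0 < kB * Ttr / m := by positivity
  have hA := rpow_three_halves_mul_rpow_div hX β
  have e1 : π / (m / (kB * Ttr)) = π * (kB * Ttr / m) := by field_simp
  have e2 : 2 * π * kB * Ttr / m = 2 * π * (kB * Ttr / m) := by ring
  have e3 : (4 * (kB * Ttr / m)) ^ ((β + 3) / 2) =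
      (m / 4) ^ (-((β + 3) / 2)) * (1 / (kB * Ttr)) ^ (-((β + 3) / 2)) := by
    rw [← mul_rpow (by positivity) (by positivity), rpow_neg (by positivity),
      ← inv_rpow (by positivity)]
    congr 1
    field_simp
  have e4 : (1 / (kB * Tint)) ^ (-(δ + α)) =
      ((kB * Tint) ^ (δ / 2)) ^ 2 * (kB ^ α * Tint ^ α) := by
    rw [one_div, inv_rpow hT.le, rpow_neg hT.le, inv_inv, rpow_add hT, mul_rpow (z := α) hkB.le hTint.le,
      ← rpow_natCast, ← rpow_mul hT.le]
    norm_num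
  have e5 : (kB * Ttr / m) ^ (β / 2) = kB ^ (β / 2) * Ttr ^ (β / 2) / m ^ (β / 2) := by
    rw [div_rpow (by positivity) hm.le, mul_rpow hkB.le hTtr.le]
  have e6 : Gamma (δ / 2 + 1) = δ / 2 * Gamma (δ / 2) := Gamma_add_one (by positivity)
  have e7 : Gamma (δ + 1) = δ * Gamma δ := Gamma_add_one (by positivity)
  have e8 : Gamma ((β + 5) / 2) = (β + 3) / 2 * Gamma ((β + 3) / 2) := by
    rw [← Gamma_add_one (by positivity)]
    ring_nf
  have e9 : kB ^ (α + 1 + β / 2) = kB ^ α * kB * kB ^ (β / 2) := by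
    rw [rpow_add hkB, rpow_add hkB, rpow_one]
  have e10 : m ^ (2 + β / 2) = m ^ 2 * m ^ (β / 2) := by
    rw [rpow_add hm, rpow_two]
  have e11 : (2 : ℝ) ^ (β + 2) = 2 ^ β * 4 := by
    rw [rpow_add two_pos]
    norm_num
  have e12 : ((δ + α) / (1 / (kB * Tint)) + (β + 3) / 2 / (1 / (kB * Ttr))) /
      (δ + α + (β + 3) / 2) - 1 / (1 / (kB * Tint)) =
      (β + 3) / 2 * kB * (Ttr - Tint) / (δ + α + (β + 3) / 2) := by
    have : δ + α + (β + 3) / 2 ≠ 0 := by positivity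
    field_simp
    ring
  have hd : (kB * Tint) ^ (δ / 2) ≠ 0 := by positivity
  have g1 : Gamma (δ + α + (β + 3) / 2) ≠ 0 := (Gamma_pos_of_pos (by positivity)).ne'
  have g2 : Gamma (δ + α) ≠ 0 := (Gamma_pos_of_pos (by positivity)).ne'
  have g3 : Gamma ((β + 3) / 2) ≠ 0 := (Gamma_pos_of_pos (by positivity)).ne'
  have g4 : Gamma (δ / 2) ≠ 0 := (Gamma_pos_of_pos (by positivity)).ne'
  have g5 : Gamma δ ≠ 0 := (Gamma_pos_of_pos (by positivity)).ne'
  have hb : δ + α + (β + 3) / 2 ≠ 0 := by positivity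
  rw [e3, e5] at hA
  rw [e1, e2, e4, e6, e7, e8, e9, e10, e11, e12]
  have hm2 : m ^ (β / 2) ≠ 0 := by positivity
  have hY : (2 * π * (kB * Ttr / m)) ^ ((3 : ℝ) / 2) ≠ 0 := by positivity
  generalize (π * (kB * Ttr / m)) ^ ((3 : ℝ) / 2) = Z at hA ⊢
  generalize (2 * π * (kB * Ttr / m)) ^ ((3 : ℝ) / 2) = Y at hA hY ⊢
  generalize (m / 4) ^ (-((β + 3) / 2)) = M at hA ⊢
  generalize (1 / (kB * Ttr)) ^ (-((β + 3) / 2)) = N at hA ⊢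
  generalize (kB * Tint) ^ (δ / 2) = D at hd ⊢
  generalize δ + α + (β + 3) / 2 = c at g1 hb ⊢
  trans 8 * π ^ 2 * (Z * (M * N) / Y ^ 2) * (1 / 2 * Cr * n ^ 2 * (kB ^ α * Tint ^ α) *
    Gamma (δ / 2) ^ 2 * Gamma (δ + α + 1) / Gamma δ ^ 2 *
    ((β + 3) / 2 * Gamma ((β + 3) / 2) * kB * (Ttr - Tint) / c))
  · field_simp
    ring
  · rw [hA]
    field_simp
    ring
end
end

section
/- Evaluation of the relaxation integral Ω: let δ ≥ 2, α ∈ [0, δ/2), β ∈ [0, 1], let ϑ_int > 0, and let η ∈ {−1, 1} be such that 1/ϑ_int + η > 0; set ϑ_tr = (1/ϑ_int + η)^{−1}. Then ∫₀^∞ ∫_v^∞ ∫₀^q (q−s)^{(β+1)/2} (q−v)^{(β+1)/2} q^{−(δ+α+(β+1)/2)} s^{δ+α−1} v^{δ+α} e^{−q/ϑ_int} ( e^{−ηs} − e^{−ηv} ) ds dq dv = η · [Γ(δ+α) Γ((β+3)/2) / Γ(δ+α+(β+5)/2)] · Γ((β+5)/2) Γ(δ+α+1) · ϑ_tr^{δ+α+1}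 ϑ_int^{(β+5)/2}. -/
noncomputable section

open MeasureTheory Real
open scoped BigOperators RealInnerProductSpace

/-- The incomplete Laplace-type convolution `∫₀^q (q - s)^c s^d e^{-ηs} ds`. -/
def expBetaIntegral (η c d q : ℝ) : ℝ :=
  ∫ s in (0:ℝ)..q, (q - s) ^ c * s ^ d * Real.exp (-η * s)

lemma continuous_expBeta_integrand {c d : ℝ} (hc : 0 ≤ c) (hd : 0 ≤ d) (η q : ℝ) :
    Continuous fun s : ℝ => (q - s) ^ c * s ^ d * Real.exp (-η * s) :=
  (((continuous_const.sub continuous_id).rpow_const fun _ => Or.inr hc).mul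
    (continuous_id.rpow_const fun _ => Or.inr hd)).mul (by fun_prop)

lemma expBetaIntegral_nonneg (η c d : ℝ) {q : ℝ} (hq : 0 ≤ q) :
    0 ≤ expBetaIntegral η c d q := by
  refine intervalIntegral.integral_nonneg hq fun s hs => ?_
  have h₁ : 0 ≤ q - s := sub_nonneg.2 hs.2
  have h₂ : 0 ≤ s := hs.1
  positivity

lemma integrableOn_rpow_mul_exp_neg_mul {d p : ℝ} (hd : 0 ≤ d) (hp : 0 < p) :
    IntegrableOn (fun t : ℝ => t ^ d * Real.exp (-(p * t))) (Set.Ioi 0) := by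
  have key := Real.integral_rpow_mul_exp_neg_mul_Ioi (a := d + 1) (by linarith) hp
  rw [add_sub_cancel_right] at key
  refine Integrable.of_integral_ne_zero ?_
  rw [key]
  have := Real.Gamma_pos_of_pos (show 0 < d + 1 by linarith)
  positivity

lemma exp_mul_expBetaIntegral_eq (η p c d q : ℝ) :
    Real.exp (-(p * q)) * expBetaIntegral η c d q =
      ∫ t in (0:ℝ)..q, ContinuousLinearMap.mul ℝ ℝ (t ^ d * Real.exp (-((p + η) * t)))
        ((q - t) ^ c * Real.exp (-(p * (q - t)))) := by
  rw [expBetaIntegral, ← intervalIntegral.integral_const_mul]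
  refine intervalIntegral.integral_congr fun t _ => ?_
  have h : Real.exp (-(p * q)) * Real.exp (-η * t) =
      Real.exp (-((p + η) * t)) * Real.exp (-(p * (q - t))) := by
    rw [← Real.exp_add, ← Real.exp_add]
    ring_nf
  simp only [ContinuousLinearMap.mul_apply']
  linear_combination (q - t) ^ c * t ^ d * h

/-- The Laplace transform of `expBetaIntegral`. -/
lemma laplace_expBetaIntegral {η p c d : ℝ} (hc : 0 ≤ c) (hd : 0 ≤ d) (hp : 0 < p)
    (hpη : 0 < p + η) :
    IntegrableOn (fun q => Real.exp (-(p * q)) * expBetaIntegral η c d q) (Set.Ioi 0) ∧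
    ∫ q in Set.Ioi (0:ℝ), Real.exp (-(p * q)) * expBetaIntegral η c d q =
      ((1 / (p + η)) ^ (d + 1) * Real.Gamma (d + 1)) *
        ((1 / p) ^ (c + 1) * Real.Gamma (c + 1)) := by
  have hf := integrableOn_rpow_mul_exp_neg_mul hd hpη
  have hg := integrableOn_rpow_mul_exp_neg_mul hc hp
  simp only [exp_mul_expBetaIntegral_eq]
  constructor
  · exact (integrable_indicator_iff measurableSet_Ioi).1
      (integrable_posConvolution hf hg (ContinuousLinearMap.mul ℝ ℝ))
  · rw [integral_posConvolution hf hg (ContinuousLinearMap.mul ℝ ℝ),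
      ContinuousLinearMap.mul_apply']
    congr 1
    · simpa using Real.integral_rpow_mul_exp_neg_mul_Ioi (a := d + 1) (by linarith) hpη
    · simpa using Real.integral_rpow_mul_exp_neg_mul_Ioi (a := c + 1) (by linarith) hp

lemma expBetaIntegral_zero {c d q : ℝ} (hc : 0 ≤ c) (hd : 0 ≤ d) (hq : 0 < q) :
    expBetaIntegral 0 c d q = q ^ (c + d + 1) * ProbabilityTheory.beta (d + 1) (c + 1) := by
  have key := Complex.betaIntegral_scaled ((d + 1 : ℝ) : ℂ) ((c + 1 : ℝ) : ℂ) hq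
  rw [ProbabilityTheory.beta_eq_betaIntegralReal _ _ (by linarith) (by linarith)]
  have hpow : (q : ℂ) ^ (((d + 1 : ℝ) : ℂ) + ((c + 1 : ℝ) : ℂ) - 1) =
      ((q ^ (c + d + 1) : ℝ) : ℂ) := by
    rw [Complex.ofReal_cpow hq.le]
    congr 1
    push_cast
    ring
  rw [hpow] at key
  rw [← Complex.re_ofReal_mul, ← key, expBetaIntegral]
  have hint : (∫ x in (0:ℝ)..q, (x : ℂ) ^ (((d + 1 : ℝ) : ℂ) - 1) *
      ((q : ℂ) - x) ^ (((c + 1 : ℝ) : ℂ) - 1)) =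
      ∫ x in (0:ℝ)..q, (((q - x) ^ c * x ^ d * Real.exp (-0 * x) : ℝ) : ℂ) := by
    refine intervalIntegral.integral_congr fun x hx => ?_
    rw [Set.uIcc_of_le hq.le] at hx
    have h₁ : 0 ≤ q - x := sub_nonneg.2 hx.2
    have h₂ : 0 ≤ x := hx.1
    simp only [neg_zero, zero_mul, Real.exp_zero, mul_one]
    rw [Complex.ofReal_mul, Complex.ofReal_cpow h₁, Complex.ofReal_cpow h₂]
    push_cast
    ring_nf
  rw [hint, intervalIntegral.integral_ofReal, Complex.ofReal_re]

lemma mul_expBetaIntegral {c d : ℝ} (hc : 0 ≤ c) (hd : 0 ≤ d) (η : ℝ) {q : ℝ} (hq : 0 < q) :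
    q * expBetaIntegral η c d q =
      expBetaIntegral η (c + 1) d q + expBetaIntegral η c (d + 1) q := by
  unfold expBetaIntegral
  rw [← intervalIntegral.integral_add, ← intervalIntegral.integral_const_mul]
  · refine intervalIntegral.integral_congr fun s hs => ?_
    rw [Set.uIcc_of_le hq.le] at hs
    simp only [Real.rpow_add_one' (sub_nonneg.2 hs.2) (show c + 1 ≠ 0 by positivity),
      Real.rpow_add_one' hs.1 (show d + 1 ≠ 0 by positivity)]
    ring
  · exact (continuous_expBeta_integrand (by linarith) hd η q).intervalIntegrable _ _
  · exact (continuous_expBeta_integrand hc (by linarith) η q).intervalIntegrable _ _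

lemma intervalIntegral_eq_integral_indicator_lt (f : ℝ → ℝ) {q : ℝ} (hq : 0 ≤ q) :
    ∫ v in (0:ℝ)..q, f v = ∫ v in Set.Ioi (0:ℝ), (Set.Iio q).indicator f v := by
  rw [intervalIntegral.integral_of_le hq, integral_Ioc_eq_integral_Ioo,
    setIntegral_indicator measurableSet_Iio, Set.Ioi_inter_Iio]

/-- Exchanging the order of integration over the triangle `0 < v < q`. -/
lemma integral_Ioi_Ioi_swap {f : ℝ → ℝ → ℝ}
    (hf : Integrable ({z : ℝ × ℝ | z.1 < z.2}.indicator fun z => f z.1 z.2)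
      ((volume.restrict (Set.Ioi 0)).prod (volume.restrict (Set.Ioi 0)))) :
    ∫ v in Set.Ioi (0:ℝ), ∫ q in Set.Ioi v, f v q =
      ∫ q in Set.Ioi (0:ℝ), ∫ v in (0:ℝ)..q, f v q := by
  have h := integral_integral_swap
    (f := fun v q => {z : ℝ × ℝ | z.1 < z.2}.indicator (fun z => f z.1 z.2) (v, q)) hf
  convert h using 1
  · refine setIntegral_congr_fun measurableSet_Ioi fun v hv => ?_
    have : ∀ q, {z : ℝ × ℝ | z.1 < z.2}.indicator (fun z => f z.1 z.2) (v, q) =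
        (Set.Ioi v).indicator (f v) q := fun q => by simp [Set.indicator_apply]
    simp only [this]
    rw [setIntegral_indicator measurableSet_Ioi, Set.Ioi_inter_Ioi,
      sup_eq_right.2 (le_of_lt hv)]
  · refine setIntegral_congr_fun measurableSet_Ioi fun q hq => ?_
    have : ∀ v, {z : ℝ × ℝ | z.1 < z.2}.indicator (fun z => f z.1 z.2) (v, q) =
        (Set.Iio q).indicator (fun v => f v q) v := fun v => by simp [Set.indicator_apply]
    simp only [this]
    exact intervalIntegral_eq_integral_indicator_lt _ (le_of_lt hq)

lemma integrable_triangle_expBeta {η c d : ℝ} (hc : 0 ≤ c) (hd : 0 ≤ d) {h : ℝ → ℝ}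
    (hm : AEStronglyMeasurable h (volume.restrict (Set.Ioi 0)))
    (h0 : ∀ q, 0 < q → 0 ≤ h q)
    (hi : IntegrableOn (fun q => h q * expBetaIntegral η c d q) (Set.Ioi 0)) :
    Integrable ({z : ℝ × ℝ | z.1 < z.2}.indicator fun z =>
        h z.2 * ((z.2 - z.1) ^ c * z.1 ^ d * Real.exp (-η * z.1)))
      ((volume.restrict (Set.Ioi 0)).prod (volume.restrict (Set.Ioi 0))) := by
  have hmeas : AEStronglyMeasurable ({z : ℝ × ℝ | z.1 < z.2}.indicator fun z =>
        h z.2 * ((z.2 - z.1) ^ c * z.1 ^ d * Real.exp (-η * z.1)))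
      ((volume.restrict (Set.Ioi 0)).prod (volume.restrict (Set.Ioi 0))) := by
    refine AEStronglyMeasurable.indicator ?_ (measurableSet_lt measurable_fst measurable_snd)
    refine hm.comp_snd.mul (Measurable.aestronglyMeasurable ?_)
    fun_prop
  have hslice : ∀ v q, {z : ℝ × ℝ | z.1 < z.2}.indicator (fun z =>
        h z.2 * ((z.2 - z.1) ^ c * z.1 ^ d * Real.exp (-η * z.1))) (v, q) =
      (Set.Iio q).indicator
        (fun v => h q * ((q - v) ^ c * v ^ d * Real.exp (-η * v))) v := fun v q => by
    simp [Set.indicator_apply]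
  refine (integrable_prod_iff' hmeas).2 ⟨?_, ?_⟩
  · refine (ae_restrict_iff' measurableSet_Ioi).2 (ae_of_all _ fun q _ => ?_)
    simp only [hslice]
    rw [integrable_indicator_iff measurableSet_Iio, IntegrableOn,
      Measure.restrict_restrict measurableSet_Iio, Set.inter_comm, Set.Ioi_inter_Iio]
    exact (((continuous_expBeta_integrand hc hd η q).const_mul (h q)).integrableOn_Icc).mono_set
      Set.Ioo_subset_Icc_self
  · refine IntegrableOn.congr_fun hi (fun q hq => ?_) measurableSet_Ioi
    have hq' : (0:ℝ) < q := hq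
    simp only [hslice]
    rw [expBetaIntegral, ← intervalIntegral.integral_const_mul,
      intervalIntegral_eq_integral_indicator_lt _ hq'.le]
    refine setIntegral_congr_fun measurableSet_Ioi fun v hv => ?_
    have hv' : (0:ℝ) < v := hv
    simp only [Set.indicator_apply, Set.mem_Iio]
    split_ifs with hvq
    · have h₁ : 0 < q - v := sub_pos.2 hvq
      have := h0 q hq'
      rw [Real.norm_of_nonneg (by positivity)]
    · simp

lemma beta_add_one_left {a b : ℝ} (ha : 0 < a) (hb : 0 < b) :
    ProbabilityTheory.beta (a + 1) b = a / (a + b) * ProbabilityTheory.beta a b := by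
  have hab : a + b ≠ 0 := by positivity
  have hΓ := (Real.Gamma_pos_of_pos (add_pos ha hb)).ne'
  rw [ProbabilityTheory.beta, ProbabilityTheory.beta, Real.Gamma_add_one ha.ne',
    add_right_comm, Real.Gamma_add_one hab]
  field_simp

/-- The inner integral of the relaxation integral. -/
lemma relaxation_inner_integral {a b : ℝ} (ha : 1 ≤ a) (hb : 0 ≤ b) (η p v : ℝ) {q : ℝ}
    (hq : 0 < q) :
    ∫ s in Set.Ioc (0:ℝ) q, (q - s) ^ b * (q - v) ^ b * q ^ (-(a + b)) * s ^ (a - 1) * v ^ a *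
        Real.exp (-(p * q)) * (Real.exp (-η * s) - Real.exp (-η * v)) =
      q ^ (-(a + b)) * (Real.exp (-(p * q)) * expBetaIntegral η b (a - 1) q) *
          ((q - v) ^ b * v ^ a * Real.exp (-0 * v)) -
        ProbabilityTheory.beta a (b + 1) * Real.exp (-(p * q)) *
          ((q - v) ^ b * v ^ a * Real.exp (-η * v)) := by
  have ha' : 0 ≤ a - 1 := by linarith
  have hz := expBetaIntegral_zero hb ha' hq
  rw [show b + (a - 1) + 1 = a + b by ring, sub_add_cancel] at hz
  have hpow : q ^ (-(a + b)) * q ^ (a + b) = 1 := by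
    rw [← Real.rpow_add hq, neg_add_cancel, Real.rpow_zero]
  have hsplit : ∀ s : ℝ, (q - s) ^ b * (q - v) ^ b * q ^ (-(a + b)) * s ^ (a - 1) * v ^ a *
        Real.exp (-(p * q)) * (Real.exp (-η * s) - Real.exp (-η * v)) =
      ((q - v) ^ b * q ^ (-(a + b)) * v ^ a * Real.exp (-(p * q))) *
          ((q - s) ^ b * s ^ (a - 1) * Real.exp (-η * s)) -
        ((q - v) ^ b * q ^ (-(a + b)) * v ^ a * Real.exp (-(p * q)) * Real.exp (-η * v)) *
          ((q - s) ^ b * s ^ (a - 1) * Real.exp (-0 * s)) := fun s => by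
    simp only [neg_zero, zero_mul, Real.exp_zero]
    ring
  simp only [hsplit]
  rw [← intervalIntegral.integral_of_le hq.le, intervalIntegral.integral_sub
      (((continuous_expBeta_integrand hb ha' η q).const_mul _).intervalIntegrable _ _)
      (((continuous_expBeta_integrand hb ha' 0 q).const_mul _).intervalIntegrable _ _),
    intervalIntegral.integral_const_mul, intervalIntegral.integral_const_mul]
  change _ * expBetaIntegral η b (a - 1) q - _ * expBetaIntegral 0 b (a - 1) q = _
  rw [hz]
  simp only [neg_zero, zero_mul, Real.exp_zero]
  linear_combination (-((q - v) ^ b * v ^ a * Real.exp (-(p * q)) * Real.exp (-η * v) *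
    ProbabilityTheory.beta a (b + 1))) * hpow

lemma relaxation_integral_eval {a b p η : ℝ} (ha : 1 ≤ a) (hb : 0 ≤ b) (hp : 0 < p)
    (hpη : 0 < p + η) :
    ∫ v in Set.Ioi (0:ℝ), ∫ q in Set.Ioi v, ∫ s in Set.Ioc (0:ℝ) q,
        (q - s) ^ b * (q - v) ^ b * q ^ (-(a + b)) * s ^ (a - 1) * v ^ a *
          Real.exp (-(p * q)) * (Real.exp (-η * s) - Real.exp (-η * v)) =
      η * (Real.Gamma a * Real.Gamma (b + 1) / Real.Gamma (a + (b + 2))) *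
        Real.Gamma (b + 2) * Real.Gamma (a + 1) * (1 / (p + η)) ^ (a + 1) *
        (1 / p) ^ (b + 2) := by
  have ha₀ : 0 < a := by linarith
  have ha₁ : 0 ≤ a - 1 := by linarith
  have hb₁ : 0 < b + 1 := by linarith
  set C := ProbabilityTheory.beta a (b + 1) with hC
  have hCpos : 0 < C := ProbabilityTheory.beta_pos ha₀ hb₁
  let h₁ : ℝ → ℝ := fun q =>
    q ^ (-(a + b)) * (Real.exp (-(p * q)) * expBetaIntegral η b (a - 1) q)
  let h₂ : ℝ → ℝ := fun q => C * Real.exp (-(p * q))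
  obtain ⟨hiE, -⟩ := laplace_expBetaIntegral hb ha₁ hp hpη
  obtain ⟨hi₁, hv₁⟩ := laplace_expBetaIntegral (c := b + 1) (by linarith) ha₁ hp hpη
  obtain ⟨hi₂, hv₂⟩ := laplace_expBetaIntegral hb ha₀.le hp hpη
  have hm₁ : AEStronglyMeasurable h₁ (volume.restrict (Set.Ioi 0)) :=
    (Measurable.aestronglyMeasurable (by fun_prop)).mul hiE.aestronglyMeasurable
  have hm₂ : AEStronglyMeasurable h₂ (volume.restrict (Set.Ioi 0)) :=
    Continuous.aestronglyMeasurable (by fun_prop)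
  have hn₁ : ∀ q, 0 < q → 0 ≤ h₁ q := fun q hq => by
    have := expBetaIntegral_nonneg η b (a - 1) hq.le
    positivity
  have hn₂ : ∀ q, 0 < q → 0 ≤ h₂ q := fun q _ => by positivity
  have he₁ : ∀ q ∈ Set.Ioi (0:ℝ), h₁ q * expBetaIntegral 0 b a q =
      a / (a + (b + 1)) * C * (Real.exp (-(p * q)) * expBetaIntegral η (b + 1) (a - 1) q +
        Real.exp (-(p * q)) * expBetaIntegral η b a q) := fun q hq => by
    have hq' : 0 < q := hq
    have hrec := mul_expBetaIntegral hb ha₁ η hq'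
    rw [sub_add_cancel] at hrec
    have hpow : q ^ (-(a + b)) * q ^ (b + a + 1) = q := by
      rw [← Real.rpow_add hq', show -(a + b) + (b + a + 1) = 1 by ring, Real.rpow_one]
    rw [expBetaIntegral_zero hb ha₀.le hq', beta_add_one_left ha₀ hb₁, ← mul_add, ← hrec]
    linear_combination (Real.exp (-(p * q)) * expBetaIntegral η b (a - 1) q *
      (a / (a + (b + 1)) * C)) * hpow
  have he₂ : ∀ q, h₂ q * expBetaIntegral η b a q =
      C * (Real.exp (-(p * q)) * expBetaIntegral η b a q) := fun q => by
    simp only [h₂]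
    ring
  have hint₁ : IntegrableOn (fun q => h₁ q * expBetaIntegral 0 b a q) (Set.Ioi 0) :=
    IntegrableOn.congr_fun ((hi₁.add hi₂).const_mul _) (fun q hq => (he₁ q hq).symm)
      measurableSet_Ioi
  have hint₂ : IntegrableOn (fun q => h₂ q * expBetaIntegral η b a q) (Set.Ioi 0) := by
    simp only [he₂]
    exact hi₂.const_mul _
  have hswap := integral_Ioi_Ioi_swap (f := fun v q =>
      h₁ q * ((q - v) ^ b * v ^ a * Real.exp (-0 * v)) -
        h₂ q * ((q - v) ^ b * v ^ a * Real.exp (-η * v))) (by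
    rw [Set.indicator_sub]
    exact (integrable_triangle_expBeta hb ha₀.le hm₁ hn₁ hint₁).sub
      (integrable_triangle_expBeta hb ha₀.le hm₂ hn₂ hint₂))
  have hinner : ∀ q, ∫ v in (0:ℝ)..q, (h₁ q * ((q - v) ^ b * v ^ a * Real.exp (-0 * v)) -
        h₂ q * ((q - v) ^ b * v ^ a * Real.exp (-η * v))) =
      h₁ q * expBetaIntegral 0 b a q - h₂ q * expBetaIntegral η b a q := fun q => by
    rw [intervalIntegral.integral_sub
      (((continuous_expBeta_integrand hb ha₀.le 0 q).const_mul _).intervalIntegrable _ _)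
      (((continuous_expBeta_integrand hb ha₀.le η q).const_mul _).intervalIntegrable _ _),
      intervalIntegral.integral_const_mul, intervalIntegral.integral_const_mul]
    rfl
  calc _ = ∫ v in Set.Ioi (0:ℝ), ∫ q in Set.Ioi v,
          (h₁ q * ((q - v) ^ b * v ^ a * Real.exp (-0 * v)) -
            h₂ q * ((q - v) ^ b * v ^ a * Real.exp (-η * v))) := by
        refine setIntegral_congr_fun measurableSet_Ioi fun v hv => ?_
        refine setIntegral_congr_fun measurableSet_Ioi fun q hq => ?_
        exact relaxation_inner_integral ha hb η p v (lt_trans hv hq)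
    _ = (∫ q in Set.Ioi (0:ℝ), h₁ q * expBetaIntegral 0 b a q) -
          ∫ q in Set.Ioi (0:ℝ), h₂ q * expBetaIntegral η b a q := by
        rw [hswap]
        simp only [hinner]
        exact integral_sub hint₁ hint₂
    _ = _ := by
        rw [setIntegral_congr_fun measurableSet_Ioi he₁]
        simp only [he₂]
        rw [integral_const_mul, integral_const_mul, integral_add hi₁ hi₂, hv₁, hv₂, hC,
          ProbabilityTheory.beta, sub_add_cancel, show a + (b + 2) = a + (b + 1) + 1 by ring,
          show b + 2 = b + 1 + 1 by ring, Real.Gamma_add_one (s := a + (b + 1)) (by positivity),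
          Real.Gamma_add_one hb₁.ne', Real.Gamma_add_one ha₀.ne',
          Real.rpow_add_one (x := 1 / p) (by positivity) (b + 1),
          Real.rpow_add_one (x := 1 / (p + η)) (by positivity)]
        have := (Real.Gamma_pos_of_pos (show 0 < a + (b + 1) by positivity)).ne'
        have := hpη.ne'
        generalize (1 / p) ^ (b + 1) = P
        generalize (1 / (p + η)) ^ a = Q
        field_simp
        ring

/-- evaluation of the relaxation integral `Ω`. -/
theorem Omega_integral_eval (δ α β ϑint ϑtr η : ℝ)
    (hδ : 2 ≤ δ) (hα : α ∈ Set.Ico (0:ℝ) (δ / 2)) (hβ : β ∈ Set.Icc (0:ℝ) 1)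
    (hϑ : 0 < ϑint) (hη : η = 1 ∨ η = -1) (hpos : 0 < 1 / ϑint + η)
    (hϑtr : ϑtr = (1 / ϑint + η)⁻¹) :
    (∫ v in Set.Ioi (0:ℝ), ∫ q in Set.Ioi v, ∫ s in Set.Ioc (0:ℝ) q,
        (q - s) ^ ((β + 1) / 2) * (q - v) ^ ((β + 1) / 2) *
          q ^ (-(δ + α + (β + 1) / 2)) * s ^ (δ + α - 1) * v ^ (δ + α) *
          Real.exp (-q / ϑint) * (Real.exp (-η * s) - Real.exp (-η * v))) =
      η * (Real.Gamma (δ + α) * Real.Gamma ((β + 3) / 2) /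
          Real.Gamma (δ + α + (β + 5) / 2)) *
        Real.Gamma ((β + 5) / 2) * Real.Gamma (δ + α + 1) *
        ϑtr ^ (δ + α + 1) * ϑint ^ ((β + 5) / 2) := by
  have hp : 0 < 1 / ϑint := by positivity
  have key := relaxation_integral_eval (a := δ + α) (b := (β + 1) / 2)
    (by linarith [hα.1]) (by linarith [hβ.1]) hp hpos
  have hexp : ∀ q : ℝ, -(1 / ϑint * q) = -q / ϑint := fun q => by ring
  simp only [hexp] at key
  rw [key, hϑtr, one_div_one_div, one_div (1 / ϑint + η),
    show (β + 1) / 2 + 1 = (β + 3) / 2 by ring, show (β + 1) / 2 + 2 = (β + 5) / 2 by ring]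
end
end

section
/- Reduction of the resonant linearized operator for α = 0 on functions independent of the internal energy: suppose α = 0 and let h(ξ,I) = φ(ξ) where φ : ℝ³ → ℝ is measurable with all integrals below absolutely convergent. Then for all ξ ∈ ℝ³ and I ≥ 0, L_r h(ξ,I) = −C_r · (√m ρ / (2π k_B T_tr)^{3/2}) · (Γ(δ/2)²/Γ(δ)) · ∫_{ℝ³×S²} exp(−m|ξ_*−u|²/(2 k_B T_tr)) |ξ−ξ_*|^β [ φ(ξ_*') + φ(ξ') − φ(ξ_*) − φ(ξ) ] dξ_* dσ; in particular L_r h is independent of I. -/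
noncomputable section

open MeasureTheory Real
open scoped BigOperators RealInnerProductSpace

/-- The Beta integral `∫₀¹ (r(1−r))^(a−1) dr = Γ(a)² / Γ(2a)`. -/
theorem setIntegral_mul_one_sub_rpow {a : ℝ} (ha : 0 < a) :
    ∫ r in Set.Icc (0 : ℝ) 1, (r * (1 - r)) ^ (a - 1) =
      Real.Gamma a ^ 2 / Real.Gamma (2 * a) := by
  have hbeta : ProbabilityTheory.beta a a = Real.Gamma a ^ 2 / Real.Gamma (2 * a) := by
    rw [ProbabilityTheory.beta, sq, two_mul]
  rw [← hbeta, ProbabilityTheory.beta_eq_betaIntegralReal a a ha ha, Complex.betaIntegral,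
    integral_Icc_eq_integral_Ioc, intervalIntegral.integral_of_le zero_le_one,
    ← RCLike.re_eq_complex_re, ← integral_re]
  · refine setIntegral_congr_fun measurableSet_Ioc fun r hr => ?_
    have h0 : 0 ≤ r := hr.1.le
    have h1 : 0 ≤ 1 - r := by linarith [hr.2]
    simp only [RCLike.re_eq_complex_re]
    rw [Real.mul_rpow h0 h1, ← Complex.ofReal_re (r ^ (a - 1) * (1 - r) ^ (a - 1))]
    push_cast [Complex.ofReal_cpow h0, Complex.ofReal_cpow h1]
    rfl
  · have hconv := Complex.betaIntegral_convergent (u := a) (v := a) (by simpa) (by simpa)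
    rwa [intervalIntegrable_iff_integrableOn_Ioc_of_le zero_le_one] at hconv

/-- The Gamma integral at scale `b`: `∫₀^∞ t^(a−1) exp(−t/b) dt = b^a Γ(a)`. -/
theorem setIntegral_rpow_mul_exp_neg_div {a b : ℝ} (ha : 0 < a) (hb : 0 < b) :
    ∫ t in Set.Ici (0 : ℝ), t ^ (a - 1) * Real.exp (-(t / b)) = b ^ a * Real.Gamma a := by
  rw [integral_Ici_eq_integral_Ioi]
  simpa [div_eq_inv_mul] using Real.integral_rpow_mul_exp_neg_mul_Ioi ha (inv_pos.mpr hb)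

/-- reduction of the resonant linearized operator for `α = 0` on
functions independent of the internal energy. -/
theorem Lr_reduction_alpha_zero (m kB δ β Cr : ℝ)
    (hm : 0 < m) (hkB : 0 < kB) (hδ : 2 ≤ δ) (hβ : β ∈ Set.Icc (0:ℝ) 1) (hCr : 0 < Cr)
    (n Ttr Tint : ℝ) (hn : 0 < n) (hTtr : 0 < Ttr) (hTint : 0 < Tint) (u : V3)
    (φ : V3 → ℝ) (hφ : Measurable φ)
    (hint1 : ∀ (ξ : V3) (I : ℝ), 0 ≤ I →
      Integrable (fun p : ℝ × V3 × Sph × ℝ =>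
        LrIntegrand m kB δ n Ttr Tint 0 β u (fun x _ => φ x) ξ I p.1 p.2.1 p.2.2.1
          p.2.2.2) resKernelMeasure)
    (hint2 : ∀ ξ : V3,
      Integrable (fun p : V3 × Sph =>
        Real.exp (-(m * ‖p.1 - u‖ ^ 2) / (2 * kB * Ttr)) * ‖ξ - p.1‖ ^ β *
          (φ (xiStarPrimeRes ξ p.1 p.2) + φ (xiPrimeRes ξ p.1 p.2) - φ p.1 - φ ξ))
        ((volume : Measure V3).prod sphMeasure)) :
    (∀ (ξ : V3) (I : ℝ), 0 ≤ I →
      Lr m kB δ n Ttr Tint 0 β Cr u (fun x _ => φ x) ξ I =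
        -Cr * (Real.sqrt m * (m * n) / (2 * π * kB * Ttr) ^ ((3:ℝ) / 2)) *
          (Real.Gamma (δ / 2) ^ 2 / Real.Gamma δ) *
          (∫ σ : Sph, (∫ ξs : V3,
            Real.exp (-(m * ‖ξs - u‖ ^ 2) / (2 * kB * Ttr)) * ‖ξ - ξs‖ ^ β *
              (φ (xiStarPrimeRes ξ ξs σ) + φ (xiPrimeRes ξ ξs σ) - φ ξs - φ ξ))
            ∂sphMeasure)) ∧
    (∀ (ξ : V3) (I J : ℝ), 0 ≤ I → 0 ≤ J →
      Lr m kB δ n Ttr Tint 0 β Cr u (fun x _ => φ x) ξ I =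
        Lr m kB δ n Ttr Tint 0 β Cr u (fun x _ => φ x) ξ J) := by
  have key : ∀ (ξ : V3) (I : ℝ),
      Lr m kB δ n Ttr Tint 0 β Cr u (fun x _ => φ x) ξ I =
        -Cr * (Real.sqrt m * (m * n) / (2 * π * kB * Ttr) ^ ((3:ℝ) / 2)) *
          (Real.Gamma (δ / 2) ^ 2 / Real.Gamma δ) *
          (∫ σ : Sph, (∫ ξs : V3,
            Real.exp (-(m * ‖ξs - u‖ ^ 2) / (2 * kB * Ttr)) * ‖ξ - ξs‖ ^ β *
              (φ (xiStarPrimeRes ξ ξs σ) + φ (xiPrimeRes ξ ξs σ) - φ ξs - φ ξ))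
            ∂sphMeasure) := by
    intro ξ I
    have : IsFiniteMeasure sphMeasure := by unfold sphMeasure; infer_instance
    have ha : 0 < δ / 2 := by linarith
    have hb : 0 < kB * Tint := mul_pos hkB hTint
    set c : ℝ := n / ((2 * π * kB * Ttr / m) ^ ((3 : ℝ) / 2) * (kB * Tint) ^ (δ / 2) *
      Real.Gamma (δ / 2)) with hc
    have hsplit : ∀ (Is : ℝ) (ξs : V3) (σ : Sph) (r : ℝ),
        LrIntegrand m kB δ n Ttr Tint 0 β u (fun x _ => φ x) ξ I Is ξs σ r =
          (c * (Is ^ (δ / 2 - 1) * Real.exp (-(Is / (kB * Tint))))) *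
            ((Real.exp (-(m * ‖ξs - u‖ ^ 2) / (2 * kB * Ttr)) * ‖ξ - ξs‖ ^ β *
              (φ (xiStarPrimeRes ξ ξs σ) + φ (xiPrimeRes ξ ξs σ) - φ ξs - φ ξ)) *
              (r * (1 - r)) ^ (δ / 2 - 1)) := by
      intro Is ξs σ r
      simp only [LrIntegrand, Mr, Real.rpow_zero, sub_eq_add_neg (-(m * ‖ξs - u‖ ^ 2) / _),
        Real.exp_add, hc]
      ring
    have hconst : c * ((kB * Tint) ^ (δ / 2) * Real.Gamma (δ / 2)) =
        Real.sqrt m * (m * n) / (2 * π * kB * Ttr) ^ ((3 : ℝ) / 2) := by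
      have hG : Real.Gamma (δ / 2) ≠ 0 := (Real.Gamma_pos_of_pos ha).ne'
      have hT : (kB * Tint) ^ (δ / 2) ≠ 0 := (Real.rpow_pos_of_pos hb _).ne'
      have hP : 0 < 2 * π * kB * Ttr := by positivity
      have hP' : (2 * π * kB * Ttr) ^ ((3 : ℝ) / 2) ≠ 0 := (Real.rpow_pos_of_pos hP _).ne'
      have hM : m ^ ((3 : ℝ) / 2) = Real.sqrt m * m := by
        rw [Real.sqrt_eq_rpow, show (3 : ℝ) / 2 = 1 / 2 + 1 by norm_num,
          Real.rpow_add_one hm.ne']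
      have hs : Real.sqrt m ≠ 0 := (Real.sqrt_pos.mpr hm).ne'
      rw [hc, Real.div_rpow hP.le hm.le, hM]
      field_simp
    simp only [Lr, hsplit, integral_const_mul, integral_mul_const]
    rw [setIntegral_rpow_mul_exp_neg_div ha hb, setIntegral_mul_one_sub_rpow ha, hconst,
      mul_div_cancel₀ δ two_ne_zero,
      ← integral_integral_swap (f := fun (ξs : V3) (σ : Sph) =>
        Real.exp (-(m * ‖ξs - u‖ ^ 2) / (2 * kB * Ttr)) * ‖ξ - ξs‖ ^ β *
          (φ (xiStarPrimeRes ξ ξs σ) + φ (xiPrimeRes ξ ξs σ) - φ ξs - φ ξ)) (hint2 ξ)]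
    simp only [integral_const_mul]
    ring
  exact ⟨fun ξ I _ => key ξ I, fun ξ I J _ _ => (key ξ I).trans (key ξ J).symm⟩
end
end

section
/- Reduction of the resonant linearized operator for α = 0 on products with the internal-energy fluctuation: suppose α = 0 and let h(ξ,I) = (I/(k_B T_int) − δ/2) · φ(ξ) where φ : ℝ³ → ℝ is measurable with all integrals below absolutely convergent. Then for all ξ ∈ ℝ³ and I ≥ 0, L_r h(ξ,I) = −C_r · (√m ρ / (2π k_B T_tr)^{3/2}) · (Γ(δ/2)²/Γ(δ)) · (I/(k_B T_int) − δ/2) · ∫_{ℝ³×S²} exp(−m|ξ_*−u|²/(2 k_B T_tr)) |ξ−ξ_*|^β [ φ(ξ') − φ(ξ) ] dξ_* dσ. -/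
noncomputable section

open MeasureTheory Real
open scoped BigOperators RealInnerProductSpace

open scoped Pointwise in
theorem measurePreserving_neg_sphMeasure :
    MeasurePreserving (fun σ : Sph => -σ) sphMeasure sphMeasure := by
  refine ⟨measurable_neg, ?_⟩
  ext s hs
  rw [Measure.map_apply measurable_neg hs, sphMeasure, Measure.toSphere_apply' _ hs,
    Measure.toSphere_apply' _ (measurable_neg hs)]
  have himage : Set.Ioo (0 : ℝ) 1 • ((↑) '' ((fun σ : Sph => -σ) ⁻¹' s) : Set V3) =
      -(Set.Ioo (0 : ℝ) 1 • ((↑) '' s : Set V3)) := by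
    ext x
    simp only [Set.mem_smul, Set.mem_image, Set.mem_preimage, Set.mem_neg]
    constructor
    · rintro ⟨t, ht, _, ⟨y, hy, rfl⟩, rfl⟩
      exact ⟨t, ht, _, ⟨-y, hy, rfl⟩, by simp⟩
    · rintro ⟨t, ht, _, ⟨y, hy, rfl⟩, hx⟩
      exact ⟨t, ht, _, ⟨-y, by simpa using hy, rfl⟩, by simp [hx]⟩
  rw [himage, Measure.measure_neg]

theorem integral_prod_prod {X Y Z : Type*} [MeasurableSpace X] [MeasurableSpace Y]
    [MeasurableSpace Z] {μ : Measure X} {ν : Measure Y} {κ : Measure Z} [SFinite μ] [SFinite ν]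
    [SFinite κ] {f : X × Y × Z → ℝ} (hf : Integrable f (μ.prod (ν.prod κ))) :
    ∫ p, f p ∂(μ.prod (ν.prod κ)) = ∫ x, (∫ y, (∫ z, f (x, y, z) ∂κ) ∂ν) ∂μ := by
  rw [integral_prod _ hf]
  refine integral_congr_ae ?_
  filter_upwards [hf.prod_right_ae] with x hx
  exact integral_prod _ hx

theorem integrableOn_Ici_rpow_mul_exp_neg_div {a s : ℝ} (ha : 0 < a) (hs : -1 < s) :
    IntegrableOn (fun x : ℝ => x ^ s * exp (-(x / a))) (Set.Ici 0) := by
  rw [integrableOn_Ici_iff_integrableOn_Ioi]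
  have h := integrableOn_rpow_mul_exp_neg_mul_rpow hs one_pos (inv_pos.mpr ha)
  refine h.congr_fun (fun x _ => ?_) measurableSet_Ioi
  simp only [rpow_one]
  congr 2
  ring

theorem integral_Ici_rpow_mul_exp_neg_div {a s : ℝ} (ha : 0 < a) (hs : 0 < s) :
    ∫ x in Set.Ici (0 : ℝ), x ^ (s - 1) * exp (-(x / a)) = a ^ s * Gamma s := by
  rw [integral_Ici_eq_integral_Ioi]
  have h := integral_rpow_mul_exp_neg_mul_Ioi hs (inv_pos.mpr ha)
  rw [one_div, inv_inv] at h
  rw [← h]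
  refine setIntegral_congr_fun measurableSet_Ioi fun x _ => ?_
  simp only [div_eq_inv_mul]

/-- An affine function integrated against the Gamma density with shape `s` and scale `a`. -/
theorem integral_Ici_gamma_affine {a s : ℝ} (ha : 0 < a) (hs : 0 < s) (A B : ℝ) :
    ∫ x in Set.Ici (0 : ℝ), x ^ (s - 1) * exp (-(x / a)) * (A + B * x) =
      a ^ s * Gamma s * (A + B * (a * s)) := by
  have hmoment : Set.EqOn (fun x : ℝ => x ^ (s - 1) * exp (-(x / a)) * (A + B * x))
      (fun x => A * (x ^ (s - 1) * exp (-(x / a))) +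
        B * (x ^ (s + 1 - 1) * exp (-(x / a)))) (Set.Ici 0) := by
    intro x hx
    have hpow : x ^ (s + 1 - 1) = x ^ (s - 1) * x := by
      rw [← rpow_add_one' hx (by linarith)]
      congr 1
      ring
    simp only [hpow]
    ring
  rw [setIntegral_congr_fun measurableSet_Ici hmoment, integral_add, integral_const_mul,
    integral_const_mul, integral_Ici_rpow_mul_exp_neg_div ha hs,
    integral_Ici_rpow_mul_exp_neg_div ha (by linarith), Gamma_add_one hs.ne', rpow_add_one ha.ne']
  · ring
  · exact (integrableOn_Ici_rpow_mul_exp_neg_div ha (by linarith)).const_mul A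
  · exact (integrableOn_Ici_rpow_mul_exp_neg_div ha (by linarith)).const_mul B

theorem integral_Icc_rpow_mul_one_sub {s : ℝ} (hs : 0 < s) :
    ∫ r in Set.Icc (0 : ℝ) 1, (r * (1 - r)) ^ (s - 1) = Gamma s ^ 2 / Gamma (2 * s) := by
  have hbeta := ProbabilityTheory.beta_eq_betaIntegralReal s s hs hs
  rw [ProbabilityTheory.beta, ← sq, ← two_mul] at hbeta
  have hcast : Complex.betaIntegral s s =
      ((∫ r in (0 : ℝ)..1, (r * (1 - r)) ^ (s - 1) : ℝ) : ℂ) := by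
    rw [Complex.betaIntegral, ← intervalIntegral.integral_ofReal]
    refine intervalIntegral.integral_congr fun x hx => ?_
    rw [Set.uIcc_of_le zero_le_one] at hx
    have hx' : 0 ≤ 1 - x := by linarith [hx.2]
    simp only [mul_rpow hx.1 hx']
    push_cast [Complex.ofReal_cpow hx.1, Complex.ofReal_cpow hx']
    rfl
  rw [hbeta, hcast, Complex.ofReal_re, integral_Icc_eq_integral_Ioc,
    ← intervalIntegral.integral_of_le zero_le_one]

/-- An affine function integrated against the symmetric Beta density with shape `s`. -/
theorem integral_Icc_beta_affine {s : ℝ} (hs : 1 ≤ s) (A B : ℝ) :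
    ∫ r in Set.Icc (0 : ℝ) 1, (r * (1 - r)) ^ (s - 1) * (A + B * r) =
      Gamma s ^ 2 / Gamma (2 * s) * (A + B / 2) := by
  have hcont : Continuous fun r : ℝ => (r * (1 - r)) ^ (s - 1) :=
    (by fun_prop : Continuous fun r : ℝ => r * (1 - r)).rpow_const
      fun _ => Or.inr (by linarith)
  have hmass := integral_Icc_rpow_mul_one_sub (s := s) (by linarith)
  rw [integral_Icc_eq_integral_Ioc, ← intervalIntegral.integral_of_le zero_le_one] at hmass ⊢
  have hflip := intervalIntegral.integral_comp_sub_left (a := 0) (b := 1)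
    (fun r : ℝ => (r * (1 - r)) ^ (s - 1) * (A + B * r)) 1
  simp only [sub_self, sub_zero, sub_sub_cancel] at hflip
  have hsum : (∫ r in (0 : ℝ)..1, (r * (1 - r)) ^ (s - 1) * (A + B * r)) +
      ∫ r in (0 : ℝ)..1, ((1 - r) * r) ^ (s - 1) * (A + B * (1 - r)) =
      ∫ r in (0 : ℝ)..1, (2 * A + B) * (r * (1 - r)) ^ (s - 1) := by
    rw [← intervalIntegral.integral_add]
    · refine intervalIntegral.integral_congr fun r _ => ?_
      simp only [mul_comm (1 - r) r]
      ring
    · exact Continuous.intervalIntegrable (by fun_prop) _ _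
    · have hcont' : Continuous fun r : ℝ => ((1 - r) * r) ^ (s - 1) := by
        simpa only [mul_comm] using hcont
      exact Continuous.intervalIntegrable (by fun_prop) _ _
  rw [hflip, intervalIntegral.integral_const_mul, hmass] at hsum
  linarith

theorem xiPrimeRes_neg (ξ ξs : V3) (σ : Sph) : xiPrimeRes ξ ξs (-σ) = xiStarPrimeRes ξ ξs σ := by
  simp [xiPrimeRes, xiStarPrimeRes, sub_eq_add_neg]

/-- For `α = 0` and the internal-energy fluctuation, the integrals over the internal variables
`I_*` and `r` are explicit. -/
theorem integral_integral_LrIntegrand_fluctuation {m kB δ n Ttr Tint : ℝ} (β : ℝ)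
    (hm : 0 < m) (hkB : 0 < kB) (hδ : 2 ≤ δ) (hTtr : 0 < Ttr) (hTint : 0 < Tint) (u : V3)
    (φ : V3 → ℝ) (ξ : V3) (I : ℝ) (ξs : V3) (σ : Sph) :
    ∫ r in Set.Icc (0 : ℝ) 1, ∫ Is in Set.Ici (0 : ℝ),
      LrIntegrand m kB δ n Ttr Tint 0 β u (fun x J => (J / (kB * Tint) - δ / 2) * φ x)
        ξ I Is ξs σ r =
      sqrt m * (m * n) / (2 * π * kB * Ttr) ^ ((3 : ℝ) / 2) *
        (Gamma (δ / 2) ^ 2 / Gamma δ) * (I / (kB * Tint) - δ / 2) *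
        (exp (-(m * ‖ξs - u‖ ^ 2) / (2 * kB * Ttr)) * ‖ξ - ξs‖ ^ β *
          ((φ (xiPrimeRes ξ ξs σ) + φ (xiStarPrimeRes ξ ξs σ)) / 2 - φ ξ)) := by
  have hδ' : 0 < δ / 2 := by linarith
  obtain ⟨a, ha, hadef⟩ : ∃ a, 0 < a ∧ kB * Tint = a := ⟨_, mul_pos hkB hTint, rfl⟩
  have hpow : n / ((2 * π * kB * Ttr / m) ^ ((3 : ℝ) / 2) * a ^ (δ / 2) * Gamma (δ / 2)) *
      (a ^ (δ / 2) * Gamma (δ / 2)) =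
      sqrt m * (m * n) / (2 * π * kB * Ttr) ^ ((3 : ℝ) / 2) := by
    have hb : 0 < 2 * π * kB * Ttr := by positivity
    have hm32 : m ^ ((3 : ℝ) / 2) = sqrt m * m := by
      rw [sqrt_eq_rpow, ← rpow_add_one hm.ne']
      norm_num
    have hG := Gamma_pos_of_pos hδ'
    rw [div_rpow hb.le hm.le, hm32]
    field_simp
  set c := n / ((2 * π * kB * Ttr / m) ^ ((3 : ℝ) / 2) * a ^ (δ / 2) * Gamma (δ / 2)) with hc
  set E := exp (-(m * ‖ξs - u‖ ^ 2) / (2 * kB * Ttr)) with hE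
  set φ' := φ (xiPrimeRes ξ ξs σ) with hφ'
  set φs' := φ (xiStarPrimeRes ξ ξs σ) with hφs'
  have hinner : ∀ r : ℝ, ∫ Is in Set.Ici (0 : ℝ),
      LrIntegrand m kB δ n Ttr Tint 0 β u (fun x J => (J / (kB * Tint) - δ / 2) * φ x)
        ξ I Is ξs σ r =
      (c * (a ^ (δ / 2) * Gamma (δ / 2)) * E * ‖ξ - ξs‖ ^ β) * ((r * (1 - r)) ^ (δ / 2 - 1) *
        ((I / a * φs' - δ / 2 * φ' - (I / a - δ / 2) * φ ξ) +
          (I / a + δ / 2) * (φ' - φs') * r)) := by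
    intro r
    have hintegrand : ∀ Is : ℝ,
        LrIntegrand m kB δ n Ttr Tint 0 β u (fun x J => (J / (kB * Tint) - δ / 2) * φ x)
          ξ I Is ξs σ r =
        (c * E * ‖ξ - ξs‖ ^ β * (r * (1 - r)) ^ (δ / 2 - 1)) *
          (Is ^ (δ / 2 - 1) * exp (-(Is / a)) *
            ((((1 - r) * I / a - δ / 2) * φs' + (r * I / a - δ / 2) * φ' + δ / 2 * φ ξs -
              (I / a - δ / 2) * φ ξ) + ((1 - r) * φs' + r * φ' - φ ξs) / a * Is)) := by
      intro Is
      simp only [LrIntegrand, Mr, IPrimeRes, IStarPrimeRes, rpow_zero, hadef, ← hφ', ← hφs']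
      rw [sub_eq_add_neg (-(m * ‖ξs - u‖ ^ 2) / (2 * kB * Ttr)), exp_add, ← hE, hc]
      ring
    simp only [hintegrand]
    rw [integral_const_mul, integral_Ici_gamma_affine ha hδ']
    field_simp
    ring
  simp only [hinner]
  rw [integral_const_mul, integral_Icc_beta_affine (by linarith), hpow, hadef,
    mul_div_cancel₀ δ two_ne_zero]
  ring

/-- reduction of the resonant linearized operator for `α = 0` on
products with the internal-energy fluctuation. -/
theorem Lr_reduction_alpha_zero_fluctuation (m kB δ β Cr : ℝ)
    (hm : 0 < m) (hkB : 0 < kB) (hδ : 2 ≤ δ) (hβ : β ∈ Set.Icc (0:ℝ) 1) (hCr : 0 < Cr)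
    (n Ttr Tint : ℝ) (hn : 0 < n) (hTtr : 0 < Ttr) (hTint : 0 < Tint) (u : V3)
    (φ : V3 → ℝ) (hφ : Measurable φ)
    (hint1 : ∀ (ξ : V3) (I : ℝ), 0 ≤ I →
      Integrable (fun p : ℝ × V3 × Sph × ℝ =>
        LrIntegrand m kB δ n Ttr Tint 0 β u
          (fun x J => (J / (kB * Tint) - δ / 2) * φ x) ξ I p.1 p.2.1 p.2.2.1
          p.2.2.2) resKernelMeasure)
    (hint2 : ∀ ξ : V3,
      Integrable (fun p : V3 × Sph =>
        Real.exp (-(m * ‖p.1 - u‖ ^ 2) / (2 * kB * Ttr)) * ‖ξ - p.1‖ ^ β *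
          (φ (xiPrimeRes ξ p.1 p.2) - φ ξ))
        ((volume : Measure V3).prod sphMeasure)) :
    ∀ (ξ : V3) (I : ℝ), 0 ≤ I →
      Lr m kB δ n Ttr Tint 0 β Cr u (fun x J => (J / (kB * Tint) - δ / 2) * φ x) ξ I =
        -Cr * (Real.sqrt m * (m * n) / (2 * π * kB * Ttr) ^ ((3:ℝ) / 2)) *
          (Real.Gamma (δ / 2) ^ 2 / Real.Gamma δ) * (I / (kB * Tint) - δ / 2) *
          (∫ σ : Sph, (∫ ξs : V3,
            Real.exp (-(m * ‖ξs - u‖ ^ 2) / (2 * kB * Ttr)) * ‖ξ - ξs‖ ^ β *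
              (φ (xiPrimeRes ξ ξs σ) - φ ξ)) ∂sphMeasure) := by
  intro ξ I hI
  have hF := hint1 ξ I hI
  have hH := hint2 ξ
  set H : V3 × Sph → ℝ := fun p =>
    exp (-(m * ‖p.1 - u‖ ^ 2) / (2 * kB * Ttr)) * ‖ξ - p.1‖ ^ β * (φ (xiPrimeRes ξ p.1 p.2) - φ ξ)
    with hHdef
  have : SFinite sphMeasure := by unfold sphMeasure; infer_instance
  have hneg := (MeasurePreserving.id (volume : Measure V3)).prod measurePreserving_neg_sphMeasure
  have hHneg := (hneg.integrable_comp hH.aestronglyMeasurable).mpr hH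
  have hemb : MeasurableEmbedding (Prod.map id fun σ : Sph => -σ : V3 × Sph → V3 × Sph) :=
    ((MeasurableEquiv.refl V3).prodCongr (MeasurableEquiv.neg Sph)).measurableEmbedding
  have hHint := hneg.integral_comp hemb H
  rw [resKernelMeasure] at hF
  have hswap : (∫ Is in Set.Ici (0 : ℝ), ∫ ξs : V3,
      (∫ σ : Sph, (∫ r in Set.Icc (0 : ℝ) 1,
        LrIntegrand m kB δ n Ttr Tint 0 β u (fun x J => (J / (kB * Tint) - δ / 2) * φ x)
          ξ I Is ξs σ r) ∂sphMeasure)) =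
      ∫ ξs : V3, (∫ σ : Sph, (∫ r in Set.Icc (0 : ℝ) 1, ∫ Is in Set.Ici (0 : ℝ),
        LrIntegrand m kB δ n Ttr Tint 0 β u (fun x J => (J / (kB * Tint) - δ / 2) * φ x)
          ξ I Is ξs σ r) ∂sphMeasure) := by
    rw [← integral_prod_prod hF.integral_prod_right, ← integral_prod_symm _ hF,
      integral_prod _ hF]
    refine integral_congr_ae ?_
    filter_upwards [hF.prod_right_ae] with Is hIs
    exact (integral_prod_prod hIs).symm
  rw [Lr, hswap]
  simp only [integral_integral_LrIntegrand_fluctuation β hm hkB hδ hTtr hTint]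
  set K := sqrt m * (m * n) / (2 * π * kB * Ttr) ^ ((3 : ℝ) / 2) *
    (Gamma (δ / 2) ^ 2 / Gamma δ) * (I / (kB * Tint) - δ / 2) with hK
  have hsymm : ∀ (ξs : V3) (σ : Sph),
      K * (exp (-(m * ‖ξs - u‖ ^ 2) / (2 * kB * Ttr)) * ‖ξ - ξs‖ ^ β *
        ((φ (xiPrimeRes ξ ξs σ) + φ (xiStarPrimeRes ξ ξs σ)) / 2 - φ ξ)) =
      K / 2 * (H (ξs, σ) + (H ∘ Prod.map id fun σ : Sph => -σ) (ξs, σ)) := by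
    intro ξs σ
    simp only [hHdef, Function.comp_apply, Prod.map_apply, id_eq, xiPrimeRes_neg]
    ring
  have htotal : ∫ p, K / 2 * (H p + (H ∘ Prod.map id fun σ : Sph => -σ) p)
      ∂((volume : Measure V3).prod sphMeasure) =
      K * ∫ σ : Sph, (∫ ξs : V3, H (ξs, σ)) ∂sphMeasure := by
    rw [integral_const_mul, integral_add hH hHneg]
    simp only [Function.comp_apply]
    rw [hHint, integral_prod_symm _ hH]
    ring
  rw [integral_prod (fun p => K / 2 * (H p + (H ∘ Prod.map id fun σ : Sph => -σ) p))
    ((hH.add hHneg).const_mul (K / 2))] at htotal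
  simp only [hsymm]
  rw [htotal, hK, hHdef]
  ring
end
end

section
/- Vanishing of the first-order source term for Chapman–Enskog corrections: let 𝒜, ℬ, 𝒞 : [0,∞) × [0,∞) → ℝ be measurable, let (τ_{ij}) be a real symmetric 3×3 matrix and b, d ∈ ℝ³, and define h₁(ξ,I) = Σ_{i,j} τ_{ij} (c_i c_j − (1/3)|c|² δ_{ij}) 𝒜(|c|,I) + Σ_j b_j c_j ℬ(|c|,I) + Σ_j d_j c_j 𝒞(|c|,I), where c = ξ − u. Assume all the integrals below converge absolutely. Then ∫_{ℝ³×[0,∞)} I · Q_s(M_r, M_r h₁)(ξ,I) dξ dI = 0. -/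
noncomputable section

open MeasureTheory Real
open scoped BigOperators RealInnerProductSpace

/-- The map induced on the unit sphere by a linear isometry. -/
def sphMap (e : V3 ≃ₗᵢ[ℝ] V3) (σ : Sph) : Sph :=
  ⟨e σ, by rw [mem_sphere_zero_iff_norm, e.norm_map, norm_eq_of_mem_sphere]⟩

/-- The isometry of `ℝ³` with linear part `e` that fixes `u`. -/
def rotAbout (u : V3) (e : V3 ≃ₗᵢ[ℝ] V3) (ξ : V3) : V3 := e (ξ - u) + u

open scoped Pointwise in
lemma measurePreserving_sphMap (e : V3 ≃ₗᵢ[ℝ] V3) :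
    MeasurePreserving (sphMap e) sphMeasure sphMeasure := by
  have hmeas : Measurable (sphMap e) :=
    (e.continuous.measurable.comp measurable_subtype_coe).subtype_mk
  refine ⟨hmeas, Measure.ext fun s hs => ?_⟩
  rw [Measure.map_apply hmeas hs, sphMeasure, Measure.toSphere_apply' _ hs,
    Measure.toSphere_apply' _ (hmeas hs)]
  congr 1
  rw [← e.measurePreserving.measure_preimage_emb e.toHomeomorph.measurableEmbedding
    (Set.Ioo (0 : ℝ) 1 • (Subtype.val '' s))]
  congr 1
  ext x
  simp only [Set.mem_smul, Set.mem_image, Set.mem_preimage]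
  constructor
  · rintro ⟨t, ht, _, ⟨σ, hσ, rfl⟩, rfl⟩
    exact ⟨t, ht, _, ⟨_, hσ, rfl⟩, (e.map_smul t (σ : V3)).symm⟩
  · rintro ⟨t, ht, _, ⟨σ, hσ, rfl⟩, h⟩
    have hσ' : sphMap e (sphMap e.symm σ) = σ := Subtype.ext (e.apply_symm_apply _)
    refine ⟨t, ht, _, ⟨sphMap e.symm σ, hσ'.symm ▸ hσ, rfl⟩, e.injective ?_⟩
    rw [e.map_smul]
    exact (congrArg (fun y : Sph => t • (y : V3)) hσ').trans h

instance : IsFiniteMeasure sphMeasure := by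
  unfold sphMeasure; infer_instance

/-- The product measure `dσ dr dR` for the scattering parameters. -/
def paramMeasure : Measure (Sph × ℝ × ℝ) :=
  sphMeasure.prod (((volume : Measure ℝ).restrict (Set.Icc 0 1)).prod
    ((volume : Measure ℝ).restrict (Set.Icc 0 1)))

instance : SFinite paramMeasure := by
  unfold paramMeasure; infer_instance

lemma stdMeasure_eq : stdMeasure = (volume : Measure V3).prod
    (((volume : Measure ℝ).restrict (Set.Ici 0)).prod ((volume : Measure V3).prod
      (((volume : Measure ℝ).restrict (Set.Ici 0)).prod paramMeasure))) := rfl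

lemma measurePreserving_rotAbout (u : V3) (e : V3 ≃ₗᵢ[ℝ] V3) :
    MeasurePreserving (rotAbout u e) volume volume :=
  (measurePreserving_add_right volume u).comp
    (e.measurePreserving.comp (measurePreserving_sub_right volume u))

/-- Simultaneous rotation of both velocities and of the scattering direction. -/
def collRot (u : V3) (e : V3 ≃ₗᵢ[ℝ] V3) :
    V3 × ℝ × V3 × ℝ × Sph × ℝ × ℝ → V3 × ℝ × V3 × ℝ × Sph × ℝ × ℝ :=
  Prod.map (rotAbout u e) (Prod.map id (Prod.map (rotAbout u e)
    (Prod.map id (Prod.map (sphMap e) id))))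

lemma measurePreserving_collRot (u : V3) (e : V3 ≃ₗᵢ[ℝ] V3) :
    MeasurePreserving (collRot u e) stdMeasure stdMeasure := by
  have hparam : MeasurePreserving (Prod.map (sphMap e) id) paramMeasure paramMeasure :=
    (measurePreserving_sphMap e).prod (MeasurePreserving.id _)
  rw [stdMeasure_eq]
  exact (measurePreserving_rotAbout u e).prod ((MeasurePreserving.id _).prod
    ((measurePreserving_rotAbout u e).prod ((MeasurePreserving.id _).prod hparam)))

lemma rotAbout_sub_rotAbout (u : V3) (e : V3 ≃ₗᵢ[ℝ] V3) (ξ ξs : V3) :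
    rotAbout u e ξ - rotAbout u e ξs = e (ξ - ξs) := by
  simp [rotAbout, map_sub]

lemma collE_rotAbout (m : ℝ) (u : V3) (e : V3 ≃ₗᵢ[ℝ] V3) (ξ ξs : V3) (I Is : ℝ) :
    collE m (rotAbout u e ξ) (rotAbout u e ξs) I Is = collE m ξ ξs I Is := by
  rw [collE, rotAbout_sub_rotAbout, e.norm_map, collE]

lemma xiPrimeStd_rotAbout (m : ℝ) (u : V3) (e : V3 ≃ₗᵢ[ℝ] V3) (ξ ξs : V3) (I Is R : ℝ) (σ : Sph) :
    xiPrimeStd m (rotAbout u e ξ) (rotAbout u e ξs) I Is R (sphMap e σ) =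
      rotAbout u e (xiPrimeStd m ξ ξs I Is R σ) := by
  simp only [xiPrimeStd, collE_rotAbout]
  simp only [rotAbout, sphMap, map_sub, map_add, map_smul]
  module

lemma xiStarPrimeStd_rotAbout (m : ℝ) (u : V3) (e : V3 ≃ₗᵢ[ℝ] V3) (ξ ξs : V3) (I Is R : ℝ)
    (σ : Sph) :
    xiStarPrimeStd m (rotAbout u e ξ) (rotAbout u e ξs) I Is R (sphMap e σ) =
      rotAbout u e (xiStarPrimeStd m ξ ξs I Is R σ) := by
  simp only [xiStarPrimeStd, collE_rotAbout]
  simp only [rotAbout, sphMap, map_sub, map_add, map_smul]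
  module

/-- The collision integrand is equivariant under rotations about `u`. -/
lemma stdIntegrand_rotAbout (m δ α β Cs : ℝ) (f F : V3 → ℝ → ℝ) (u : V3) (e : V3 ≃ₗᵢ[ℝ] V3)
    (ξ : V3) (I : ℝ) (ξs : V3) (Is : ℝ) (σ : Sph) (r R : ℝ) :
    stdIntegrand m δ α β Cs f F (rotAbout u e ξ) I (rotAbout u e ξs) Is (sphMap e σ) r R =
      stdIntegrand m δ α β Cs (fun x => f (rotAbout u e x)) (fun x => F (rotAbout u e x))
        ξ I ξs Is σ r R := by
  simp only [stdIntegrand, xiPrimeStd_rotAbout, xiStarPrimeStd_rotAbout, IPrimeStd, IStarPrimeStd,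
    collE_rotAbout, rotAbout_sub_rotAbout, e.norm_map]

/-- The collision integrand is additive in its second argument. -/
lemma sum_stdIntegrand {ι : Type*} [Fintype ι] (m δ α β Cs : ℝ) (f : V3 → ℝ → ℝ)
    (F : ι → V3 → ℝ → ℝ) (ξ : V3) (I : ℝ) (ξs : V3) (Is : ℝ) (σ : Sph) (r R : ℝ) :
    ∑ i, stdIntegrand m δ α β Cs f (F i) ξ I ξs Is σ r R =
      stdIntegrand m δ α β Cs f (fun x J => ∑ i, F i x J) ξ I ξs Is σ r R := by
  simp only [stdIntegrand, ← Finset.sum_mul, Finset.sum_sub_distrib, ← Finset.sum_div,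
    Finset.sum_add_distrib, ← Finset.mul_sum]

/-- If `f` is invariant under finitely many rotations about `u`, over which `F` averages to zero,
then the energy moment of the collision integrand vanishes. -/
lemma integral_stdIntegrand_eq_zero {ι : Type*} [Fintype ι] [Nonempty ι] (m δ α β Cs : ℝ)
    (f F : V3 → ℝ → ℝ) (u : V3) (e : ι → V3 ≃ₗᵢ[ℝ] V3)
    (hf : ∀ i x, f (rotAbout u (e i) x) = f x)
    (hF : ∀ x J, ∑ i, F (rotAbout u (e i) x) J = 0)
    (hint : Integrable (fun p : V3 × ℝ × V3 × ℝ × Sph × ℝ × ℝ =>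
      stdIntegrand m δ α β Cs f F p.1 p.2.1 p.2.2.1 p.2.2.2.1 p.2.2.2.2.1 p.2.2.2.2.2.1
        p.2.2.2.2.2.2 * p.2.1) stdMeasure) :
    ∫ p, stdIntegrand m δ α β Cs f F p.1 p.2.1 p.2.2.1 p.2.2.2.1 p.2.2.2.2.1 p.2.2.2.2.2.1
      p.2.2.2.2.2.2 * p.2.1 ∂stdMeasure = 0 := by
  set G : V3 × ℝ × V3 × ℝ × Sph × ℝ × ℝ → ℝ := fun p =>
    stdIntegrand m δ α β Cs f F p.1 p.2.1 p.2.2.1 p.2.2.2.1 p.2.2.2.2.1 p.2.2.2.2.2.1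
      p.2.2.2.2.2.2 * p.2.1 with hG
  have hinv (i : ι) : ∫ p, G (collRot u (e i) p) ∂stdMeasure = ∫ p, G p ∂stdMeasure := by
    have hT := measurePreserving_collRot u (e i)
    rw [← integral_map hT.measurable.aemeasurable (by rw [hT.map_eq]; exact hint.1), hT.map_eq]
  have hsum (p) : ∑ i, G (collRot u (e i) p) = 0 := by
    simp only [hG, collRot, Prod.map, id, ← Finset.sum_mul]
    simp only [stdIntegrand_rotAbout, hf, sum_stdIntegrand, hF]
    simp [stdIntegrand]
  have hcard : (Fintype.card ι : ℝ) * ∫ p, G p ∂stdMeasure = 0 := by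
    calc (Fintype.card ι : ℝ) * ∫ p, G p ∂stdMeasure
        = ∑ i, ∫ p, G (collRot u (e i) p) ∂stdMeasure := by simp [hinv]
      _ = ∫ p, ∑ i, G (collRot u (e i) p) ∂stdMeasure :=
          (integral_finsetSum _ fun i _ =>
            (measurePreserving_collRot u (e i)).integrable_comp_of_integrable hint).symm
      _ = 0 := by simp [hsum]
  exact (mul_eq_zero.mp hcard).resolve_left (by simp)

lemma integral_paramMeasure {g : Sph × ℝ × ℝ → ℝ} (hg : Integrable g paramMeasure) :
    ∫ z, g z ∂paramMeasure =
      ∫ σ, (∫ r in Set.Icc (0 : ℝ) 1, ∫ R in Set.Icc (0 : ℝ) 1, g (σ, r, R)) ∂sphMeasure := by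
  rw [paramMeasure] at hg ⊢
  rw [integral_prod _ hg]
  refine integral_congr_ae ?_
  filter_upwards [hg.prod_right_ae] with σ hσ
  exact integral_prod _ hσ

lemma integral_collision {g : V3 × ℝ × Sph × ℝ × ℝ → ℝ}
    (hg : Integrable g ((volume : Measure V3).prod
      (((volume : Measure ℝ).restrict (Set.Ici 0)).prod paramMeasure))) :
    ∫ q, g q ∂((volume : Measure V3).prod
        (((volume : Measure ℝ).restrict (Set.Ici 0)).prod paramMeasure)) =
      ∫ Is in Set.Ici (0 : ℝ), ∫ ξs : V3, (∫ σ, (∫ r in Set.Icc (0 : ℝ) 1,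
        ∫ R in Set.Icc (0 : ℝ) 1, g (ξs, Is, σ, r, R)) ∂sphMeasure) := by
  have hassoc := measurePreserving_prodAssoc (volume : Measure V3)
    ((volume : Measure ℝ).restrict (Set.Ici 0)) paramMeasure
  have hg' := hassoc.integrable_comp_of_integrable hg
  have hae : (fun q : V3 × ℝ => ∫ z, g (q.1, q.2, z) ∂paramMeasure)
      =ᵐ[(volume : Measure V3).prod ((volume : Measure ℝ).restrict (Set.Ici 0))]
      fun q => ∫ σ, (∫ r in Set.Icc (0 : ℝ) 1, ∫ R in Set.Icc (0 : ℝ) 1,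
        g (q.1, q.2, σ, r, R)) ∂sphMeasure := by
    filter_upwards [hg'.prod_right_ae] with q hq
    exact integral_paramMeasure hq
  rw [← hassoc.integral_comp']
  refine (integral_prod _ hg').trans ((integral_congr_ae hae).trans ?_)
  exact integral_prod_symm _ (hg'.integral_prod_left.congr hae)

/-- The energy moment of `Q_s` as a single integral over all collision variables. -/
lemma integral_mul_Qs (m δ α β Cs : ℝ) (f F : V3 → ℝ → ℝ)
    (hint : Integrable (fun p : V3 × ℝ × V3 × ℝ × Sph × ℝ × ℝ =>
      stdIntegrand m δ α β Cs f F p.1 p.2.1 p.2.2.1 p.2.2.2.1 p.2.2.2.2.1 p.2.2.2.2.2.1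
        p.2.2.2.2.2.2 * p.2.1) stdMeasure) :
    ∫ p, p.2 * Qs m δ α β Cs f F p.1 p.2 ∂phaseMeasure =
      1 / 2 * ∫ p, stdIntegrand m δ α β Cs f F p.1 p.2.1 p.2.2.1 p.2.2.2.1 p.2.2.2.2.1
        p.2.2.2.2.2.1 p.2.2.2.2.2.2 * p.2.1 ∂stdMeasure := by
  have hassoc := measurePreserving_prodAssoc (volume : Measure V3)
    ((volume : Measure ℝ).restrict (Set.Ici 0))
    ((volume : Measure V3).prod (((volume : Measure ℝ).restrict (Set.Ici 0)).prod paramMeasure))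
  have hint' := hassoc.integrable_comp_of_integrable hint
  rw [stdMeasure_eq, ← hassoc.integral_comp', ← integral_const_mul]
  refine Eq.trans ?_ (integral_prod _ (hint'.const_mul (1 / 2))).symm
  refine integral_congr_ae ?_
  filter_upwards [hint'.prod_right_ae] with p hp
  rw [integral_const_mul, Qs, mul_left_comm, mul_comm p.2]
  congr 1
  refine Eq.trans ?_ (integral_collision hp).symm
  change _ = ∫ Is in Set.Ici (0 : ℝ), ∫ ξs : V3, (∫ σ, (∫ r in Set.Icc (0 : ℝ) 1,
    ∫ R in Set.Icc (0 : ℝ) 1, stdIntegrand m δ α β Cs f F p.1 p.2 ξs Is σ r R * p.2) ∂sphMeasure)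
  simp only [integral_mul_const]

/-- The rotations by a cyclic shift and an even number of sign changes of the coordinates: the
rotation group of the tetrahedron. -/
def tetraRot (k : Fin 3 × Fin 4) : V3 ≃ₗᵢ[ℝ] V3 :=
  (LinearIsometryEquiv.piLpCongrLeft 2 ℝ ℝ (Equiv.addRight k.1)).trans
    (LinearIsometryEquiv.piLpCongrRight 2 fun i : Fin 3 =>
      if k.2 = 0 ∨ k.2 = i.succ then .refl ℝ ℝ else .neg ℝ)

lemma tetraRot_apply (k : Fin 3 × Fin 4) (x : V3) (i : Fin 3) :
    tetraRot k x i = (if k.2 = 0 ∨ k.2 = i.succ then 1 else -1) * x (i - k.1) := by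
  simp only [tetraRot, LinearIsometryEquiv.trans_apply, LinearIsometryEquiv.piLpCongrRight_apply]
  split_ifs <;> simp [LinearIsometryEquiv.piLpCongrLeft_apply, sub_eq_add_neg]

/-- Traceless quadratic forms and linear forms average to zero over the tetrahedral group. -/
lemma sum_tetraRot_eq_zero (τ : Matrix (Fin 3) (Fin 3) ℝ) (b d c : V3) (A B C : ℝ) :
    ∑ k, ((∑ i : Fin 3, ∑ j : Fin 3, τ i j *
          (tetraRot k c i * tetraRot k c j - 1 / 3 * ‖c‖ ^ 2 * (if i = j then 1 else 0)) * A) +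
        (∑ j : Fin 3, b j * tetraRot k c j * B) + (∑ j : Fin 3, d j * tetraRot k c j * C)) = 0 := by
  rw [EuclideanSpace.real_norm_sq_eq, Fintype.sum_prod_type]
  simp only [tetraRot_apply, Fin.sum_univ_three, Fin.sum_univ_four]
  simp [Fin.ext_iff, show (-1 : Fin 3) = 2 from rfl, show (-2 : Fin 3) = 1 from rfl]
  ring

lemma Mr_rotAbout (m kB δ n Ttr Tint : ℝ) (u : V3) (e : V3 ≃ₗᵢ[ℝ] V3) (x : V3) :
    Mr m kB δ n Ttr Tint u (rotAbout u e x) = Mr m kB δ n Ttr Tint u x := by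
  ext J
  simp only [Mr, rotAbout, add_sub_cancel_right, e.norm_map]

/-- vanishing of the first-order source term for Chapman–Enskog
corrections. -/
theorem source_term_first_order_vanishes (m kB δ α β Cr Cs : ℝ) (hm : 0 < m) (hkB : 0 < kB) (hδ : 2 ≤ δ)
    (hα : α ∈ Set.Ico (0:ℝ) (δ / 2)) (hβ : β ∈ Set.Icc (0:ℝ) 1) (hCr : 0 < Cr)
    (hCs : Cs = Real.Gamma (δ + α + (β + 3) / 2) /
      (Real.Gamma ((β + 3) / 2) * Real.Gamma (δ + α)) * Cr)
    (n Ttr Tint : ℝ) (hn : 0 < n) (hTtr : 0 < Ttr) (hTint : 0 < Tint) (u : V3)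
    (𝒜 ℬ 𝒞 : ℝ → ℝ → ℝ)
    (hA : Measurable (Function.uncurry 𝒜)) (hB : Measurable (Function.uncurry ℬ))
    (hC : Measurable (Function.uncurry 𝒞))
    (τ : Matrix (Fin 3) (Fin 3) ℝ) (hτ : ∀ i j, τ i j = τ j i)
    (b d : V3)
    (h₁ : V3 → ℝ → ℝ)
    (hh₁ : h₁ = fun ξ I =>
      (∑ i : Fin 3, ∑ j : Fin 3, τ i j *
          ((ξ - u) i * (ξ - u) j - 1 / 3 * ‖ξ - u‖ ^ 2 * (if i = j then 1 else 0)) *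
          𝒜 ‖ξ - u‖ I) +
        (∑ j : Fin 3, b j * (ξ - u) j * ℬ ‖ξ - u‖ I) +
        (∑ j : Fin 3, d j * (ξ - u) j * 𝒞 ‖ξ - u‖ I))
    (hint1 : Integrable (fun p : V3 × ℝ =>
        p.2 * Qs m δ α β Cs (Mr m kB δ n Ttr Tint u)
          (fun x J => Mr m kB δ n Ttr Tint u x J * h₁ x J) p.1 p.2) phaseMeasure)
    (hint2 : Integrable (fun p : V3 × ℝ × V3 × ℝ × Sph × ℝ × ℝ =>
        stdIntegrand m δ α β Cs (Mr m kB δ n Ttr Tint u)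
            (fun x J => Mr m kB δ n Ttr Tint u x J * h₁ x J)
            p.1 p.2.1 p.2.2.1 p.2.2.2.1 p.2.2.2.2.1 p.2.2.2.2.2.1 p.2.2.2.2.2.2 *
          p.2.1) stdMeasure) :
    (∫ p, p.2 * Qs m δ α β Cs (Mr m kB δ n Ttr Tint u)
        (fun x J => Mr m kB δ n Ttr Tint u x J * h₁ x J) p.1 p.2 ∂phaseMeasure) = 0 := by
  rw [integral_mul_Qs _ _ _ _ _ _ _ hint2,
    integral_stdIntegrand_eq_zero _ _ _ _ _ _ _ u tetraRot
      (fun k x => Mr_rotAbout m kB δ n Ttr Tint u (tetraRot k) x) ?_ hint2, mul_zero]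
  intro x J
  simp only [Mr_rotAbout, ← Finset.mul_sum]
  refine mul_eq_zero_of_right _ ?_
  simp only [hh₁, rotAbout, add_sub_cancel_right, LinearIsometryEquiv.norm_map]
  exact sum_tetraRot_eq_zero τ b d (x - u) (𝒜 ‖x - u‖ J) (ℬ ‖x - u‖ J) (𝒞 ‖x - u‖ J)
end
end

section
/- Pointwise estimate on the equilibrium collision term: suppose T_tr ≠ T_int and set ζ = k_B T_tr T_int / |T_tr − T_int|. Then there exists a constant C > 0, depending only on m, k_B, δ, α, β, C_r, n, u, T_tr, T_int, such that for all ξ ∈ ℝ³ and I > 0, writing c = ξ − u: if T_tr > T_int then M_r(ξ,I)^{−1} |Q_s(M_r, M_r)(ξ,I)| ≤ C |T_tr − T_int| (1 + |c|² + |c|^{β+2}) (1 + I + I^{α+1}) e^{I/ζ}, and if T_tr < T_int then M_r(ξ,I)^{−1} |Q_s(M_r, M_r)(ξ,I)| ≤ C |T_tr − T_int| (1 + |c|² + |c|^{β+2}) (1 + I + I^{α+1}) e^{m|c|²/(2ζ)}. -/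
noncomputable section

open MeasureTheory Real
open scoped BigOperators RealInnerProductSpace

theorem abs_integral_Icc_zero_one_le {f : ℝ → ℝ} {B : ℝ}
    (h : ∀ x ∈ Set.Ioo (0 : ℝ) 1, |f x| ≤ B) : |∫ x in Set.Icc (0 : ℝ) 1, f x| ≤ B := by
  rw [integral_Icc_eq_integral_Ioo]
  simpa using norm_setIntegral_le_of_norm_le_const (μ := (volume : Measure ℝ))
    (s := Set.Ioo (0 : ℝ) 1) measure_Ioo_lt_top fun x hx =>
      (norm_eq_abs _).trans_le (h x hx)

theorem one_add_rpow_le {a x : ℝ} (ha : 0 ≤ a) (hx : 0 ≤ x) :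
    (1 + x) ^ a ≤ 2 ^ a * (1 + x ^ (a + 1)) := by
  rcases le_total x 1 with h | h
  · calc (1 + x) ^ a ≤ 2 ^ a := rpow_le_rpow (by linarith) (by linarith) ha
      _ ≤ 2 ^ a * (1 + x ^ (a + 1)) :=
        le_mul_of_one_le_right (by positivity) (by linarith [rpow_nonneg hx (a + 1)])
  · calc (1 + x) ^ a ≤ (2 * x) ^ a := rpow_le_rpow (by linarith) (by linarith) ha
      _ = 2 ^ a * x ^ a := mul_rpow two_pos.le hx
      _ ≤ 2 ^ a * (1 + x ^ (a + 1)) := by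
        gcongr
        linarith [rpow_le_rpow_of_exponent_le h (show a ≤ a + 1 by linarith)]

theorem one_add_mul_exp_neg_mul_sq_le {b : ℝ} (hb : 0 < b) (x : ℝ) :
    (1 + x) * exp (-b * x ^ 2) ≤ (2 + 2 / b) * exp (-(b / 2) * x ^ 2) := by
  have hpoly : 1 + x ≤ (2 + 2 / b) * (b / 2 * x ^ 2 + 1) := by
    have : (2 + 2 / b) * (b / 2 * x ^ 2 + 1) = b * x ^ 2 + x ^ 2 + 2 + 2 / b := by
      field_simp
      ring
    have h1 : 0 ≤ b * x ^ 2 := by positivity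
    have h2 : 0 < 2 / b := by positivity
    nlinarith [sq_nonneg (x - 1)]
  calc (1 + x) * exp (-b * x ^ 2)
      ≤ (2 + 2 / b) * exp (b / 2 * x ^ 2) * exp (-b * x ^ 2) := by
        gcongr
        exact hpoly.trans (by gcongr; exact add_one_le_exp _)
    _ = (2 + 2 / b) * exp (-(b / 2) * x ^ 2) := by
        rw [mul_assoc, ← exp_add]
        ring_nf

theorem integrable_exp_neg_mul_norm_sub_sq {V : Type*} [NormedAddCommGroup V]
    [InnerProductSpace ℝ V] [FiniteDimensional ℝ V] [MeasurableSpace V] [BorelSpace V]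
    {b : ℝ} (hb : 0 < b) (u : V) : Integrable fun v : V => exp (-b * ‖v - u‖ ^ 2) := by
  have h : Integrable fun v : V => exp (-b * ‖v‖ ^ 2) := by
    refine Integrable.of_integral_ne_zero ?_
    rw [GaussianFourier.integral_rexp_neg_mul_sq_norm hb]
    positivity
  exact h.comp_sub_right u

theorem integrableOn_one_add_rpow_mul_rpow_mul_exp {a p b : ℝ} (ha : 0 ≤ a) (hp : 0 ≤ p)
    (hb : 0 < b) :
    IntegrableOn (fun x : ℝ => (1 + x ^ a) * (x ^ p * exp (-b * x))) (Set.Ioi 0) := by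
  have h (s : ℝ) (hs : 0 ≤ s) : IntegrableOn (fun x : ℝ => x ^ s * exp (-b * x)) (Set.Ioi 0) := by
    simpa using integrableOn_rpow_mul_exp_neg_mul_rpow (s := s) (by linarith) one_pos hb
  refine IntegrableOn.congr_fun ((h p hp).add (h (a + p) (by positivity))) (fun x hx => ?_)
    measurableSet_Ioi
  simp only [Pi.add_apply, rpow_add hx]
  ring

/-- The normalization constant of the two-temperature equilibrium distribution `Mr`. -/
def MrConst (m kB δ n Ttr Tint : ℝ) : ℝ :=
  n / ((2 * π * kB * Ttr / m) ^ ((3 : ℝ) / 2) * (kB * Tint) ^ (δ / 2) * Real.Gamma (δ / 2))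

section Bounds

variable {m kB δ α β Cs n Ttr Tint : ℝ}

theorem MrConst_pos (hm : 0 < m) (hkB : 0 < kB) (hδ : 0 < δ) (hn : 0 < n) (hTtr : 0 < Ttr)
    (hTint : 0 < Tint) : 0 < MrConst m kB δ n Ttr Tint := by
  have := Gamma_pos_of_pos (half_pos hδ)
  unfold MrConst
  positivity

theorem Mr_eq (u ξ : V3) (I : ℝ) :
    Mr m kB δ n Ttr Tint u ξ I = MrConst m kB δ n Ttr Tint * I ^ (δ / 2 - 1) *
      exp (-((kB * Ttr)⁻¹ * (m / 2 * ‖ξ - u‖ ^ 2) + (kB * Tint)⁻¹ * I)) := by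
  unfold Mr MrConst
  congr 2
  · ring
  · simp only [div_eq_mul_inv, mul_inv]
    ring

theorem Mr_pos (hm : 0 < m) (hkB : 0 < kB) (hδ : 0 < δ) (hn : 0 < n) (hTtr : 0 < Ttr)
    (hTint : 0 < Tint) (u ξ : V3) {I : ℝ} (hI : 0 < I) : 0 < Mr m kB δ n Ttr Tint u ξ I := by
  have := MrConst_pos hm hkB hδ hn hTtr hTint
  rw [Mr_eq]
  positivity

/-- The symmetrized product of two equilibrium distributions is controlled by the total energy of
the pair. -/
theorem Mr_pair_div_le {ν : ℝ} (hm : 0 < m) (hνtr : ν ≤ (kB * Ttr)⁻¹)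
    (hνint : ν ≤ (kB * Tint)⁻¹) (u ξ₁ ξ₂ : V3) {I₁ I₂ : ℝ} (h₁ : 0 < I₁) (h₂ : 0 < I₂) :
    (Mr m kB δ n Ttr Tint u ξ₁ I₁ * Mr m kB δ n Ttr Tint u ξ₂ I₂ +
        Mr m kB δ n Ttr Tint u ξ₂ I₂ * Mr m kB δ n Ttr Tint u ξ₁ I₁) / (I₁ * I₂) ^ (δ / 2 - 1) ∈
      Set.Icc 0 (2 * MrConst m kB δ n Ttr Tint ^ 2 *
        exp (-(ν * (m / 2 * (‖ξ₁ - u‖ ^ 2 + ‖ξ₂ - u‖ ^ 2) + (I₁ + I₂))))) := by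
  set A := MrConst m kB δ n Ttr Tint with hA
  set e := -((kB * Ttr)⁻¹ * (m / 2 * ‖ξ₁ - u‖ ^ 2) + (kB * Tint)⁻¹ * I₁) +
    -((kB * Ttr)⁻¹ * (m / 2 * ‖ξ₂ - u‖ ^ 2) + (kB * Tint)⁻¹ * I₂) with he
  have key : (Mr m kB δ n Ttr Tint u ξ₁ I₁ * Mr m kB δ n Ttr Tint u ξ₂ I₂ +
        Mr m kB δ n Ttr Tint u ξ₂ I₂ * Mr m kB δ n Ttr Tint u ξ₁ I₁) / (I₁ * I₂) ^ (δ / 2 - 1) =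
      2 * A ^ 2 * exp e := by
    have hp : 0 < (I₁ * I₂) ^ (δ / 2 - 1) := by positivity
    rw [div_eq_iff hp.ne', mul_rpow h₁.le h₂.le, Mr_eq, Mr_eq, he, exp_add, ← hA]
    ring
  rw [key]
  refine ⟨by positivity, ?_⟩
  gcongr
  have hx : 0 ≤ m / 2 * (‖ξ₁ - u‖ ^ 2 + ‖ξ₂ - u‖ ^ 2) := by positivity
  have hI : 0 ≤ I₁ + I₂ := by positivity
  linarith [mul_le_mul_of_nonneg_right hνtr hx, mul_le_mul_of_nonneg_right hνint hI]

theorem collE_pos (hm : 0 < m) (ξ ξs : V3) {I Is : ℝ} (hI : 0 < I) (hIs : 0 < Is) :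
    0 < collE m ξ ξs I Is := by
  unfold collE
  positivity

/-- Conservation of total energy in a standard collision. -/
theorem std_energy_conservation (hm : 0 < m) (u ξ ξs : V3) {I Is R : ℝ} (r : ℝ) (σ : Sph)
    (hI : 0 < I) (hIs : 0 < Is) (hR : 0 ≤ R) :
    m / 2 * (‖xiPrimeStd m ξ ξs I Is R σ - u‖ ^ 2 + ‖xiStarPrimeStd m ξ ξs I Is R σ - u‖ ^ 2) +
        (IPrimeStd m ξ ξs I Is R r + IStarPrimeStd m ξ ξs I Is R r) =
      m / 2 * (‖ξ - u‖ ^ 2 + ‖ξs - u‖ ^ 2) + (I + Is) := by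
  have hE := collE_pos hm ξ ξs hI hIs
  set s := √(R * collE m ξ ξs I Is / m) with hs
  have hs2 : m * s ^ 2 = R * collE m ξ ξs I Is := by
    rw [hs, sq_sqrt (by positivity)]
    field_simp
  have hσ : ‖s • (σ : V3)‖ ^ 2 = s ^ 2 := by
    rw [norm_smul, norm_eq_of_mem_sphere σ, mul_one, norm_eq_abs, sq_abs]
  have hpost := parallelogram_law_with_norm ℝ ((1 / 2 : ℝ) • (ξ + ξs) - u) (s • (σ : V3))
  have hpre := parallelogram_law_with_norm ℝ ((1 / 2 : ℝ) • (ξ + ξs) - u) ((1 / 2 : ℝ) • (ξ - ξs))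
  have hg : ‖(1 / 2 : ℝ) • (ξ - ξs)‖ ^ 2 = ‖ξ - ξs‖ ^ 2 / 4 := by
    rw [norm_smul, mul_pow]
    norm_num
    ring
  rw [show (1 / 2 : ℝ) • (ξ + ξs) - u + (1 / 2 : ℝ) • (ξ - ξs) = ξ - u by module,
    show (1 / 2 : ℝ) • (ξ + ξs) - u - (1 / 2 : ℝ) • (ξ - ξs) = ξs - u by module] at hpre
  rw [show (1 / 2 : ℝ) • (ξ + ξs) - u + s • (σ : V3) = xiPrimeStd m ξ ξs I Is R σ - u by
      rw [xiPrimeStd, ← hs]; module,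
    show (1 / 2 : ℝ) • (ξ + ξs) - u - s • (σ : V3) = xiStarPrimeStd m ξ ξs I Is R σ - u by
      rw [xiStarPrimeStd, ← hs]; module] at hpost
  have hE' : collE m ξ ξs I Is = m / 4 * ‖ξ - ξs‖ ^ 2 + I + Is := rfl
  unfold IPrimeStd IStarPrimeStd
  linear_combination m / 2 * hpost - m / 2 * hpre + m * hσ - m * hg + hs2 + hE'

theorem abs_stdIntegrand_Mr_le {ν : ℝ} (hm : 0 < m) (hδ : 2 ≤ δ) (hα : 0 ≤ α) (hβ : 0 ≤ β)
    (hCs : 0 ≤ Cs) (hνtr : ν ≤ (kB * Ttr)⁻¹) (hνint : ν ≤ (kB * Tint)⁻¹) (u ξ ξs : V3)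
    {I Is r R : ℝ} (σ : Sph) (hI : 0 < I) (hIs : 0 < Is) (hr : r ∈ Set.Ioo (0 : ℝ) 1)
    (hR : R ∈ Set.Ioo (0 : ℝ) 1) :
    |stdIntegrand m δ α β Cs (Mr m kB δ n Ttr Tint u) (Mr m kB δ n Ttr Tint u) ξ I ξs Is σ r R| ≤
      2 * MrConst m kB δ n Ttr Tint ^ 2 *
        exp (-(ν * (m / 2 * (‖ξ - u‖ ^ 2 + ‖ξs - u‖ ^ 2) + (I + Is)))) *
        (Cs * (I + Is) ^ α * ‖ξ - ξs‖ ^ β * (I * Is) ^ (δ / 2 - 1)) := by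
  obtain ⟨hr0, hr1⟩ := hr
  obtain ⟨hR0, hR1⟩ := hR
  have hr1' : 0 < 1 - r := sub_pos.2 hr1
  have hR1' : 0 < 1 - R := sub_pos.2 hR1
  have hE := collE_pos hm ξ ξs hI hIs
  have hI' : 0 < IPrimeStd m ξ ξs I Is R r := by unfold IPrimeStd; positivity
  have hIs' : 0 < IStarPrimeStd m ξ ξs I Is R r := by unfold IStarPrimeStd; positivity
  have hpost := Mr_pair_div_le (δ := δ) (n := n) hm hνtr hνint u (xiPrimeStd m ξ ξs I Is R σ)
    (xiStarPrimeStd m ξ ξs I Is R σ) hI' hIs'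
  rw [std_energy_conservation hm u ξ ξs r σ hI hIs hR0.le] at hpost
  have hpre := Mr_pair_div_le (δ := δ) (n := n) hm hνtr hνint u ξ ξs hI hIs
  have hw : 0 ≤ Cs * (I + Is) ^ α * ‖ξ - ξs‖ ^ β * (I * Is) ^ (δ / 2 - 1) := by positivity
  have hrw : (r * (1 - r)) ^ (δ / 2 - 1) ≤ 1 :=
    rpow_le_one (by positivity) (by nlinarith) (by linarith)
  have hRw : (1 - R) ^ (α + δ - 1) ≤ 1 := rpow_le_one hR1'.le (by linarith) (by linarith)
  have hRw' : R ^ ((β + 1) / 2) ≤ 1 := rpow_le_one hR0.le hR1.le (by positivity)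
  unfold stdIntegrand
  rw [abs_mul]
  refine mul_le_mul (abs_sub_le_of_nonneg_of_le hpost.1 hpost.2 hpre.1 hpre.2) ?_ (abs_nonneg _)
    (by positivity)
  rw [abs_of_nonneg (by positivity), mul_assoc, mul_assoc _ ((r * (1 - r)) ^ _)]
  exact mul_le_of_le_one_right hw (mul_le_one₀ hrw (by positivity)
    (mul_le_one₀ hRw (by positivity) hRw'))

theorem norm_sub_rpow_le (hβ : β ∈ Set.Icc (0 : ℝ) 1) (u ξ ξs : V3) :
    ‖ξ - ξs‖ ^ β ≤ (1 + ‖ξ - u‖) * (1 + ‖ξs - u‖) := by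
  have h : ‖ξ - ξs‖ ≤ ‖ξ - u‖ + ‖ξs - u‖ := by
    simpa using norm_sub_le (ξ - u) (ξs - u)
  have h' : ‖ξ - ξs‖ ≤ (1 + ‖ξ - u‖) * (1 + ‖ξs - u‖) := by
    nlinarith [mul_nonneg (norm_nonneg (ξ - u)) (norm_nonneg (ξs - u))]
  have h1 : 1 ≤ (1 + ‖ξ - u‖) * (1 + ‖ξs - u‖) :=
    one_le_mul_of_one_le_of_one_le (by simp) (by simp)
  calc ‖ξ - ξs‖ ^ β ≤ ((1 + ‖ξ - u‖) * (1 + ‖ξs - u‖)) ^ β :=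
        rpow_le_rpow (norm_nonneg _) h' hβ.1
    _ ≤ (1 + ‖ξ - u‖) * (1 + ‖ξs - u‖) := rpow_le_self_of_one_le h1 hβ.2

theorem add_rpow_le_mul (hα : 0 ≤ α) {I Is : ℝ} (hI : 0 ≤ I) (hIs : 0 ≤ Is) :
    (I + Is) ^ α ≤ 4 ^ α * (1 + I ^ (α + 1)) * (1 + Is ^ (α + 1)) := by
  calc (I + Is) ^ α ≤ ((1 + I) * (1 + Is)) ^ α :=
        rpow_le_rpow (by positivity) (by nlinarith [mul_nonneg hI hIs]) hα
    _ = (1 + I) ^ α * (1 + Is) ^ α := mul_rpow (by positivity) (by positivity)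
    _ ≤ (2 ^ α * (1 + I ^ (α + 1))) * (2 ^ α * (1 + Is ^ (α + 1))) := by
        gcongr
        · exact one_add_rpow_le hα hI
        · exact one_add_rpow_le hα hIs
    _ = 4 ^ α * (1 + I ^ (α + 1)) * (1 + Is ^ (α + 1)) := by
        rw [show (4 : ℝ) = 2 * 2 by norm_num, mul_rpow two_pos.le two_pos.le]
        ring

/-- Pointwise estimate on the normalized integrand, with the variables `ξ`, `I` separated from the
integration variables `ξs`, `Is`. -/
theorem inv_Mr_mul_abs_stdIntegrand_le {ν : ℝ} (hm : 0 < m) (hkB : 0 < kB) (hδ : 2 ≤ δ)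
    (hα : 0 ≤ α) (hβ : β ∈ Set.Icc (0 : ℝ) 1) (hCs : 0 ≤ Cs) (hn : 0 < n) (hTtr : 0 < Ttr)
    (hTint : 0 < Tint) (hν : 0 < ν) (hνtr : ν ≤ (kB * Ttr)⁻¹) (hνint : ν ≤ (kB * Tint)⁻¹)
    (u ξ ξs : V3) {I Is r R : ℝ} (σ : Sph) (hI : 0 < I) (hIs : 0 < Is)
    (hr : r ∈ Set.Ioo (0 : ℝ) 1) (hR : R ∈ Set.Ioo (0 : ℝ) 1) :
    (Mr m kB δ n Ttr Tint u ξ I)⁻¹ *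
        |stdIntegrand m δ α β Cs (Mr m kB δ n Ttr Tint u) (Mr m kB δ n Ttr Tint u)
          ξ I ξs Is σ r R| ≤
      2 * MrConst m kB δ n Ttr Tint * Cs * 4 ^ α * (2 + 2 / (ν * (m / 2))) *
        ((1 + ‖ξ - u‖) * (1 + I ^ (α + 1)) *
          exp (((kB * Ttr)⁻¹ - ν) * (m / 2 * ‖ξ - u‖ ^ 2) + ((kB * Tint)⁻¹ - ν) * I)) *
        exp (-(ν * (m / 2) / 2) * ‖ξs - u‖ ^ 2) *
        ((1 + Is ^ (α + 1)) * (Is ^ (δ / 2 - 1) * exp (-ν * Is))) := by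
  have hA := MrConst_pos hm hkB (by linarith : 0 < δ) hn hTtr hTint
  have hM := Mr_pos hm hkB (by linarith : 0 < δ) hn hTtr hTint u ξ hI
  set A := MrConst m kB δ n Ttr Tint with hA'
  set x := ‖ξ - u‖ with hx
  set y := ‖ξs - u‖ with hy
  have hx0 : 0 ≤ x := norm_nonneg _
  have hy0 : 0 ≤ y := norm_nonneg _
  set W := exp (((kB * Ttr)⁻¹ - ν) * (m / 2 * x ^ 2) + ((kB * Tint)⁻¹ - ν) * I) with hW
  have hexp : exp (-(ν * (m / 2 * (x ^ 2 + y ^ 2) + (I + Is)))) =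
      W * exp (-(ν * (m / 2)) * y ^ 2) * exp (-ν * Is) *
        exp (-((kB * Ttr)⁻¹ * (m / 2 * x ^ 2) + (kB * Tint)⁻¹ * I)) := by
    rw [hW, ← exp_add, ← exp_add, ← exp_add]
    ring_nf
  rw [inv_mul_le_iff₀ hM]
  refine (abs_stdIntegrand_Mr_le hm hδ hα hβ.1 hCs hνtr hνint u ξ ξs σ hI hIs hr hR).trans ?_
  rw [← hA', ← hx, ← hy, hexp, mul_rpow hI.le hIs.le, Mr_eq, ← hA', ← hx]
  have hy1 := one_add_mul_exp_neg_mul_sq_le (b := ν * (m / 2)) (by positivity) y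
  set P := exp (-((kB * Ttr)⁻¹ * (m / 2 * x ^ 2) + (kB * Tint)⁻¹ * I))
  set G := exp (-(ν * (m / 2)) * y ^ 2)
  calc 2 * A ^ 2 * (W * G * exp (-ν * Is) * P) *
        (Cs * (I + Is) ^ α * ‖ξ - ξs‖ ^ β * (I ^ (δ / 2 - 1) * Is ^ (δ / 2 - 1)))
      ≤ 2 * A ^ 2 * (W * G * exp (-ν * Is) * P) *
        (Cs * (4 ^ α * (1 + I ^ (α + 1)) * (1 + Is ^ (α + 1))) * ((1 + x) * (1 + y)) *
          (I ^ (δ / 2 - 1) * Is ^ (δ / 2 - 1))) := by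
        gcongr
        · exact add_rpow_le_mul hα hI.le hIs.le
        · exact norm_sub_rpow_le hβ u ξ ξs
    _ = 2 * A ^ 2 * (W * exp (-ν * Is) * P) *
        (Cs * (4 ^ α * (1 + I ^ (α + 1)) * (1 + Is ^ (α + 1))) * (1 + x) *
          (I ^ (δ / 2 - 1) * Is ^ (δ / 2 - 1))) * ((1 + y) * G) := by ring
    _ ≤ 2 * A ^ 2 * (W * exp (-ν * Is) * P) *
        (Cs * (4 ^ α * (1 + I ^ (α + 1)) * (1 + Is ^ (α + 1))) * (1 + x) *
          (I ^ (δ / 2 - 1) * Is ^ (δ / 2 - 1))) *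
        ((2 + 2 / (ν * (m / 2))) * exp (-(ν * (m / 2) / 2) * y ^ 2)) := by gcongr
    _ = _ := by ring

/-- If the integrand is dominated by a product of integrable functions of `ξs` and `Is`, then so is
the collision operator. -/
theorem abs_Qs_le {f F : V3 → ℝ → ℝ} {ξ : V3} {I K : ℝ} {g : V3 → ℝ} {h : ℝ → ℝ}
    (hg : Integrable g) (hh : IntegrableOn h (Set.Ioi 0))
    (hb : ∀ (ξs : V3) (Is : ℝ) (σ : Sph) (r R : ℝ), 0 < Is → r ∈ Set.Ioo (0 : ℝ) 1 →
      R ∈ Set.Ioo (0 : ℝ) 1 → |stdIntegrand m δ α β Cs f F ξ I ξs Is σ r R| ≤ K * g ξs * h Is) :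
    |Qs m δ α β Cs f F ξ I| ≤ 1 / 2 * (K * sphMeasure.real Set.univ *
      (∫ ξs, g ξs) * ∫ Is in Set.Ioi 0, h Is) := by
  have : IsFiniteMeasure sphMeasure := by unfold sphMeasure; infer_instance
  unfold Qs
  rw [abs_mul, abs_of_pos (by norm_num : (0 : ℝ) < 1 / 2), integral_Ici_eq_integral_Ioi,
    ← integral_const_mul]
  gcongr
  rw [← norm_eq_abs]
  refine norm_integral_le_of_norm_le (hh.const_mul _) ?_
  filter_upwards [ae_restrict_mem measurableSet_Ioi] with Is hIs
  have hξ : (K * sphMeasure.real Set.univ * ∫ ξs, g ξs) * h Is =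
      ∫ ξs, K * sphMeasure.real Set.univ * h Is * g ξs := by
    rw [integral_const_mul]
    ring
  rw [hξ]
  refine norm_integral_le_of_norm_le (hg.const_mul _) (Filter.Eventually.of_forall fun ξs => ?_)
  rw [show K * sphMeasure.real Set.univ * h Is * g ξs =
    K * g ξs * h Is * sphMeasure.real Set.univ by ring]
  exact norm_integral_le_of_norm_le_const (Filter.Eventually.of_forall fun σ =>
    abs_integral_Icc_zero_one_le fun r hr => abs_integral_Icc_zero_one_le fun R hR =>
      hb ξs Is σ r R hIs hr hR)

/-- Estimate on the equilibrium collision term in terms of an inverse temperature `ν` below both the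
translational and the internal one. -/
theorem exists_inv_Mr_mul_abs_Qs_le {ν : ℝ} (hm : 0 < m) (hkB : 0 < kB) (hδ : 2 ≤ δ)
    (hα : 0 ≤ α) (hβ : β ∈ Set.Icc (0 : ℝ) 1) (hCs : 0 ≤ Cs) (hn : 0 < n) (hTtr : 0 < Ttr)
    (hTint : 0 < Tint) (hν : 0 < ν) (hνtr : ν ≤ (kB * Ttr)⁻¹) (hνint : ν ≤ (kB * Tint)⁻¹)
    (u : V3) :
    ∃ C : ℝ, 0 < C ∧ ∀ (ξ : V3) (I : ℝ), 0 < I →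
      (Mr m kB δ n Ttr Tint u ξ I)⁻¹ *
          |Qs m δ α β Cs (Mr m kB δ n Ttr Tint u) (Mr m kB δ n Ttr Tint u) ξ I| ≤
        C * (1 + ‖ξ - u‖ ^ 2 + ‖ξ - u‖ ^ (β + 2)) * (1 + I + I ^ (α + 1)) *
          exp (((kB * Ttr)⁻¹ - ν) * (m / 2 * ‖ξ - u‖ ^ 2) + ((kB * Tint)⁻¹ - ν) * I) := by
  have hA := MrConst_pos hm hkB (by linarith : 0 < δ) hn hTtr hTint
  set g : V3 → ℝ := fun ξs => exp (-(ν * (m / 2) / 2) * ‖ξs - u‖ ^ 2) with hg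
  set h : ℝ → ℝ := fun Is => (1 + Is ^ (α + 1)) * (Is ^ (δ / 2 - 1) * exp (-ν * Is)) with hh
  have hgi : Integrable g := integrable_exp_neg_mul_norm_sub_sq (by positivity) u
  have hhi : IntegrableOn h (Set.Ioi 0) :=
    integrableOn_one_add_rpow_mul_rpow_mul_exp (by positivity) (by linarith) hν
  set K := 2 * MrConst m kB δ n Ttr Tint * Cs * 4 ^ α * (2 + 2 / (ν * (m / 2))) with hK
  have hK0 : 0 ≤ K := by positivity
  set B := K * sphMeasure.real Set.univ * (∫ ξs, g ξs) * ∫ Is in Set.Ioi 0, h Is with hB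
  have hB0 : 0 ≤ B := by
    have h1 : 0 ≤ ∫ ξs, g ξs := integral_nonneg fun _ => (exp_pos _).le
    have h2 : 0 ≤ ∫ Is in Set.Ioi 0, h Is := setIntegral_nonneg measurableSet_Ioi fun x hx => by
      have : 0 < x := hx
      positivity
    positivity
  refine ⟨B + 1, by positivity, fun ξ I hI => ?_⟩
  have hM := Mr_pos hm hkB (by linarith : 0 < δ) hn hTtr hTint u ξ hI
  set M := Mr m kB δ n Ttr Tint u ξ I
  set W := exp (((kB * Ttr)⁻¹ - ν) * (m / 2 * ‖ξ - u‖ ^ 2) + ((kB * Tint)⁻¹ - ν) * I) with hW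
  have hQ := abs_Qs_le (m := m) (δ := δ) (α := α) (β := β) (Cs := Cs)
    (f := Mr m kB δ n Ttr Tint u) (F := Mr m kB δ n Ttr Tint u) (ξ := ξ) (I := I)
    (K := M * (K * ((1 + ‖ξ - u‖) * (1 + I ^ (α + 1)) * W))) hgi hhi
    (fun ξs Is σ r R hIs hr hR => by
      have := inv_Mr_mul_abs_stdIntegrand_le hm hkB hδ hα hβ hCs hn hTtr hTint hν hνtr hνint
        u ξ ξs σ hI hIs hr hR
      rw [inv_mul_le_iff₀ hM] at this
      refine this.trans_eq ?_
      simp only [hg, hh, hK, hW]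
      ring)
  have hpoly : (1 + ‖ξ - u‖) / 2 ≤ 1 + ‖ξ - u‖ ^ 2 + ‖ξ - u‖ ^ (β + 2) := by
    nlinarith [sq_nonneg (‖ξ - u‖ - 1), rpow_nonneg (norm_nonneg (ξ - u)) (β + 2)]
  calc M⁻¹ * |Qs m δ α β Cs (Mr m kB δ n Ttr Tint u) (Mr m kB δ n Ttr Tint u) ξ I|
      ≤ B * ((1 + ‖ξ - u‖) / 2) * (1 + I ^ (α + 1)) * W := by
        rw [inv_mul_le_iff₀ hM]
        refine hQ.trans_eq ?_
        rw [hB]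
        ring
    _ ≤ (B + 1) * (1 + ‖ξ - u‖ ^ 2 + ‖ξ - u‖ ^ (β + 2)) * (1 + I + I ^ (α + 1)) * W := by
        gcongr <;> linarith

end Bounds

/-- pointwise estimate on the equilibrium collision term
`M_r⁻¹ |Q_s(M_r, M_r)|`. -/
theorem Qs_equilibrium_pointwise_estimate (m kB δ α β Cr Cs : ℝ) (hm : 0 < m) (hkB : 0 < kB) (hδ : 2 ≤ δ)
    (hα : α ∈ Set.Ico (0:ℝ) (δ / 2)) (hβ : β ∈ Set.Icc (0:ℝ) 1) (hCr : 0 < Cr)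
    (hCs : Cs = Real.Gamma (δ + α + (β + 3) / 2) /
      (Real.Gamma ((β + 3) / 2) * Real.Gamma (δ + α)) * Cr)
    (n Ttr Tint : ℝ) (hn : 0 < n) (hTtr : 0 < Ttr) (hTint : 0 < Tint)
    (hne : Ttr ≠ Tint) (u : V3)
    (ζ : ℝ) (hζ : ζ = kB * Ttr * Tint / |Ttr - Tint|) :
    ∃ C : ℝ, 0 < C ∧ ∀ (ξ : V3) (I : ℝ), 0 < I →
      (Tint < Ttr →
        (Mr m kB δ n Ttr Tint u ξ I)⁻¹ *
            |Qs m δ α β Cs (Mr m kB δ n Ttr Tint u) (Mr m kB δ n Ttr Tint u) ξ I| ≤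
          C * |Ttr - Tint| * (1 + ‖ξ - u‖ ^ 2 + ‖ξ - u‖ ^ (β + 2)) *
            (1 + I + I ^ (α + 1)) * Real.exp (I / ζ)) ∧
      (Ttr < Tint →
        (Mr m kB δ n Ttr Tint u ξ I)⁻¹ *
            |Qs m δ α β Cs (Mr m kB δ n Ttr Tint u) (Mr m kB δ n Ttr Tint u) ξ I| ≤
          C * |Ttr - Tint| * (1 + ‖ξ - u‖ ^ 2 + ‖ξ - u‖ ^ (β + 2)) *
            (1 + I + I ^ (α + 1)) * Real.exp (m * ‖ξ - u‖ ^ 2 / (2 * ζ))) := by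
  have hCs0 : 0 ≤ Cs := by
    have h1 := Gamma_pos_of_pos (by linarith [hα.1, hβ.1] : 0 < δ + α + (β + 3) / 2)
    have h2 := Gamma_pos_of_pos (by linarith [hβ.1] : 0 < (β + 3) / 2)
    have h3 := Gamma_pos_of_pos (by linarith [hα.1] : 0 < δ + α)
    rw [hCs]
    positivity
  have hζ' : 1 / ζ = |(kB * Tint)⁻¹ - (kB * Ttr)⁻¹| := by
    have h : (kB * Tint)⁻¹ - (kB * Ttr)⁻¹ = (Ttr - Tint) / (kB * Ttr * Tint) := by
      field_simp
    rw [hζ, h, abs_div, abs_of_pos (by positivity : 0 < kB * Ttr * Tint), one_div_div]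
  have habs : 0 < |Ttr - Tint| := abs_pos.2 (sub_ne_zero.2 hne)
  rcases lt_or_gt_of_ne hne with hlt | hlt
  · have hinv : (kB * Tint)⁻¹ ≤ (kB * Ttr)⁻¹ := by gcongr
    obtain ⟨C, hC, h⟩ := exists_inv_Mr_mul_abs_Qs_le hm hkB hδ hα.1 hβ hCs0 hn hTtr hTint
      (inv_pos.2 (mul_pos hkB hTint)) hinv le_rfl u
    refine ⟨C / |Ttr - Tint|, by positivity, fun ξ I hI => ⟨fun h' => absurd h' hlt.not_gt,
      fun _ => ?_⟩⟩
    rw [div_mul_cancel₀ _ habs.ne']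
    refine (h ξ I hI).trans_eq ?_
    congr 2
    rw [show m * ‖ξ - u‖ ^ 2 / (2 * ζ) = 1 / ζ * (m / 2 * ‖ξ - u‖ ^ 2) by ring, hζ',
      abs_of_nonpos (by linarith)]
    ring
  · have hinv : (kB * Ttr)⁻¹ ≤ (kB * Tint)⁻¹ := by gcongr
    obtain ⟨C, hC, h⟩ := exists_inv_Mr_mul_abs_Qs_le hm hkB hδ hα.1 hβ hCs0 hn hTtr hTint
      (inv_pos.2 (mul_pos hkB hTtr)) le_rfl hinv u
    refine ⟨C / |Ttr - Tint|, by positivity, fun ξ I hI => ⟨fun _ => ?_,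
      fun h' => absurd h' hlt.not_gt⟩⟩
    rw [div_mul_cancel₀ _ habs.ne']
    refine (h ξ I hI).trans_eq ?_
    congr 2
    rw [show I / ζ = 1 / ζ * I by ring, hζ', abs_of_nonneg (by linarith)]
    ring
end
end
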